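/- Quillen's fiber criterion for Cohen-Macaulayness (statement for finite posets): let f : P → Q be a strictly increasing map of finite posets. Suppose Q is Cohen-Macaulay of dimension d, and for every q ∈ Q the preimage f^{-1}({q' ∈ Q : q' ≤ q}) is Cohen-Macaulay of dimension equal to the height of q. Then P is Cohen-Macaulay of dimension d. -/

import Mathlib

open scoped BigOperators
noncomputable section
open Classical in
/-- The geometric realization of the simplicial complex with face predicate `P`. -/
abbrev SReal {α : Type*} [Fintype α] (P : Finset α → Prop) : Type _ :=
  {f : α → ℝ // (∀ a, 0 ≤ f a) ∧ (∑ a, f a) = 1 ∧ ∃ σ : Finset α, P σ ∧ ∀ a, f a ≠ 0 → a ∈ σ}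

/-- `X` is `n`-connected: nonempty when `n ≥ -1`, and all homotopy groups `π_i`
vanish for `0 ≤ i ≤ n`. -/
def IsConn (n : ℤ) (X : Type*) [TopologicalSpace X] : Prop :=
  (-1 ≤ n → Nonempty X) ∧
    ∀ i : ℕ, (i : ℤ) ≤ n → ∀ x : X, Subsingleton (HomotopyGroup (Fin i) X x)

/-- The complex with face predicate `P` is `d`-spherical: dimension `d` and
`(d-1)`-connected. -/
def IsSpherical {α : Type*} [Fintype α] (d : ℤ) (P : Finset α → Prop) : Prop :=
  (∀ σ, P σ → (σ.card : ℤ) ≤ d + 1) ∧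
  (0 ≤ d → ∃ σ, P σ ∧ (σ.card : ℤ) = d + 1) ∧
  IsConn (d - 1) (SReal P)

/-- The link of a face `σ`. -/
def LinkFace {α : Type*} [DecidableEq α] (P : Finset α → Prop) (σ τ : Finset α) : Prop :=
  τ.Nonempty ∧ Disjoint τ σ ∧ P (τ ∪ σ)

/-- Faces of the order complex of a poset: nonempty chains. -/
def ChainFace (P : Type*) [PartialOrder P] (σ : Finset P) : Prop :=
  σ.Nonempty ∧ IsChain (· ≤ ·) (σ : Set P)

open Classical in
/-- A finite poset is Cohen-Macaulay of dimension `d` if its order complex is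
`d`-spherical and the link of every face `σ` of the order complex is
`(d - #σ)`-spherical. -/
def PosetCM (P : Type*) [PartialOrder P] [Fintype P] (d : ℤ) : Prop :=
  IsSpherical d (ChainFace P) ∧
    ∀ σ : Finset P, ChainFace P σ →
      IsSpherical (d - σ.card) (LinkFace (ChainFace P) σ)

open Classical in
/-- The height of `q`: the maximal length of a chain in `Q` with top element `q`. -/
def posetHeight {Q : Type*} [PartialOrder Q] [Fintype Q] (q : Q) : ℕ :=
  ((Finset.univ : Finset (Finset Q)).filter fun σ =>
    ChainFace Q σ ∧ q ∈ σ ∧ ∀ x ∈ σ, x ≤ q).sup Finset.card - 1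

section QFSection
open Set Metric

namespace QF

/-- The geometric realization as a set in the ambient coordinate space. -/
def rz {α : Type*} [Fintype α] (K : Finset α → Prop) : Set (α → ℝ) :=
  {f | (∀ a, 0 ≤ f a) ∧ (∑ a, f a) = 1 ∧ ∃ σ : Finset α, K σ ∧ ∀ a, f a ≠ 0 → a ∈ σ}

/-- The map `g` on the unit sphere extends over the ball, with values in `Y`. -/
def Fills {m : ℕ} {V : Type*} [TopologicalSpace V] (Y : Set V) (g : (Fin m → ℝ) → V) : Prop :=
  ∃ G : (Fin m → ℝ) → V, ContinuousOn G (closedBall 0 1) ∧ MapsTo G (closedBall 0 1) Y ∧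
    EqOn G g (sphere 0 1)

/-- Connectivity of a subset via extension of maps from spheres to balls. -/
def SetConn {V : Type*} [TopologicalSpace V] (n : ℤ) (Y : Set V) : Prop :=
  ∀ m : ℕ, (m : ℤ) ≤ n + 1 → ∀ g : (Fin m → ℝ) → V, ContinuousOn g (sphere 0 1) →
    MapsTo g (sphere 0 1) Y → Fills Y g

lemma SetConn.mono {V : Type*} [TopologicalSpace V] {n n' : ℤ} {Y : Set V} (h : SetConn n Y)
    (hn : n' ≤ n) : SetConn n' Y := fun m hm => h m (by omega)

lemma glue {V W : Type*} [TopologicalSpace V] [TopologicalSpace W] {s t : Set V}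
    (hs : IsClosed s) (ht : IsClosed t) {f g : V → W} (hf : ContinuousOn f s)
    (hg : ContinuousOn g t) (h : ∀ x ∈ s, x ∈ t → f x = g x) :
    ∃ k : V → W, ContinuousOn k (s ∪ t) ∧ EqOn k f s ∧ EqOn k g t := by
  classical
  have h1 : EqOn (s.piecewise f g) f s := fun x hx => by simp [hx]
  have h2 : EqOn (s.piecewise f g) g t := fun x hx => by
    by_cases hxs : x ∈ s
    · simp [hxs, h x hxs hx]
    · simp [hxs]
  exact ⟨s.piecewise f g, (hf.congr h1).union_of_isClosed (hg.congr h2) hs ht, h1, h2⟩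

lemma fills_of_homotopy {m : ℕ} {V : Type*} [TopologicalSpace V] {Y : Set V}
    (H : ℝ × (Fin m → ℝ) → V) (hH : ContinuousOn H (Icc 0 1 ×ˢ sphere 0 1))
    (hM : MapsTo H (Icc 0 1 ×ˢ sphere 0 1) Y) {g : (Fin m → ℝ) → V}
    (h0 : ∀ x ∈ sphere (0 : Fin m → ℝ) 1, H (0, x) = g x)
    (h1 : Fills Y (fun x => H (1, x))) : Fills Y g := by
  obtain ⟨G, hG, hGM, hGe⟩ := h1
  set s : Set (Fin m → ℝ) := closedBall 0 (1/2)
  set t : Set (Fin m → ℝ) := {x | 1/2 ≤ ‖x‖ ∧ ‖x‖ ≤ 1}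
  have hs : IsClosed s := isClosed_closedBall
  have ht : IsClosed t := (isClosed_le continuous_const continuous_norm).inter
    (isClosed_le continuous_norm continuous_const)
  have c1 : MapsTo (fun x : Fin m → ℝ => (2:ℝ) • x) s (closedBall 0 1) := by
    intro x hx
    simp only [s, mem_closedBall, dist_zero_right] at hx ⊢
    rw [norm_smul]; norm_num; linarith
  have c2 : MapsTo (fun x : Fin m → ℝ => ((2 - 2 * ‖x‖ : ℝ), ‖x‖⁻¹ • x)) t
      (Icc 0 1 ×ˢ sphere 0 1) := by
    intro x hx
    obtain ⟨hx1, hx2⟩ := hx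
    refine ⟨⟨by simp only; linarith, by simp only; linarith⟩, ?_⟩
    simp only [mem_sphere, dist_zero_right]
    rw [norm_smul, norm_inv, norm_norm, inv_mul_cancel₀ (by linarith)]
  have hc2 : ContinuousOn (fun x : Fin m → ℝ => ((2 - 2 * ‖x‖ : ℝ), ‖x‖⁻¹ • x)) t := by
    refine ContinuousOn.prodMk (by fun_prop) (ContinuousOn.fun_smul ?_ continuousOn_id)
    refine continuous_norm.continuousOn.inv₀ ?_
    intro x hx
    have := hx.1
    linarith
  obtain ⟨k, hk, hks, hkt⟩ := glue hs ht (f := fun x => G ((2:ℝ) • x))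
    (g := fun x => H (2 - 2 * ‖x‖, ‖x‖⁻¹ • x))
    (hG.comp (by fun_prop) c1) (hH.comp hc2 c2) (by
      intro x hx1 hx2
      have e : ‖x‖ = 1/2 := le_antisymm (by simpa [s] using hx1) hx2.1
      have : (2:ℝ) • x ∈ sphere (0 : Fin m → ℝ) 1 := by
        simp [norm_smul, e]
      rw [hGe this]
      simp only [e]; norm_num)
  have hcov : closedBall (0 : Fin m → ℝ) 1 ⊆ s ∪ t := by
    intro x hx
    simp only [mem_closedBall, dist_zero_right] at hx
    rcases le_total ‖x‖ (1/2) with h | h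
    · left; simpa [s] using h
    · right; exact ⟨h, hx⟩
  refine ⟨k, hk.mono hcov, ?_, ?_⟩
  · intro x hx
    rcases hcov hx with h | h
    · rw [hks h]; exact hGM (c1 h)
    · rw [hkt h]; exact hM (c2 h)
  · intro x hx
    have e : ‖x‖ = 1 := by simpa using hx
    rw [hkt ⟨by rw [e]; norm_num, e.le⟩, ← h0 x hx]
    simp [e]

lemma Fills.congr {m : ℕ} {V : Type*} [TopologicalSpace V] {Y : Set V} {g g' : (Fin m → ℝ) → V}
    (h : Fills Y g) (e : EqOn g g' (sphere 0 1)) : Fills Y g' := by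
  obtain ⟨G, h1, h2, h3⟩ := h
  exact ⟨G, h1, h2, h3.trans e⟩

lemma Fills.mono {m : ℕ} {V : Type*} [TopologicalSpace V] {Y Y' : Set V} {g : (Fin m → ℝ) → V}
    (h : Fills Y g) (e : Y ⊆ Y') : Fills Y' g := by
  obtain ⟨G, h1, h2, h3⟩ := h
  exact ⟨G, h1, fun x hx => e (h2 hx), h3⟩

lemma SetConn.retract {V W : Type*} [TopologicalSpace V] [TopologicalSpace W] {n : ℤ}
    {Y : Set V} {Z : Set W} (h : SetConn n Y) (r : V → W) (s : W → V) (hr : ContinuousOn r Y)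
    (hrM : MapsTo r Y Z) (hs : ContinuousOn s Z) (hsM : MapsTo s Z Y)
    (hrs : ∀ z ∈ Z, r (s z) = z) : SetConn n Z := by
  intro m hm g hg hgM
  obtain ⟨G, h1, h2, h3⟩ := h m hm (fun x => s (g x)) (hs.comp hg hgM) (hsM.comp hgM)
  refine ⟨fun x => r (G x), hr.comp h1 h2, hrM.comp h2, fun x hx => ?_⟩
  show r (G x) = g x
  rw [h3 hx]
  exact hrs _ (hgM hx)

end QF

namespace QF

lemma norm_fin_succ {i : ℕ} (w : Fin (i+1) → ℝ) : ‖w‖ = max |w 0| ‖Fin.tail w‖ := by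
  apply le_antisymm
  · rw [pi_norm_le_iff_of_nonneg (le_max_of_le_left (abs_nonneg _))]
    intro j
    refine Fin.cases ?_ (fun j => ?_) j
    · exact le_max_left _ _
    · exact le_max_of_le_right (norm_le_pi_norm (Fin.tail w) j)
  · apply max_le
    · exact norm_le_pi_norm w 0
    · rw [pi_norm_le_iff_of_nonneg (norm_nonneg _)]
      intro j
      exact norm_le_pi_norm w j.succ

/-- Clamping map from the coordinate space to the unit cube. -/
def clampCube {i : ℕ} (v : Fin i → ℝ) : Fin i → unitInterval :=
  fun j => Set.projIcc 0 1 zero_le_one ((v j + 1) / 2)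

lemma continuous_clampCube {i : ℕ} : Continuous (clampCube (i := i)) := by
  unfold clampCube
  refine continuous_pi fun j => ?_
  exact continuous_projIcc.comp (by fun_prop)

lemma clampCube_boundary {i : ℕ} {v : Fin i → ℝ} (h : 1 ≤ ‖v‖) :
    clampCube v ∈ Cube.boundary (Fin i) := by
  by_contra hc
  have : ‖v‖ < 1 := by
    rw [pi_norm_lt_iff one_pos]
    intro j
    by_contra hj
    apply hc
    refine ⟨j, ?_⟩
    rw [not_lt, Real.norm_eq_abs, le_abs] at hj
    rcases hj with hj | hj
    · right
      exact Set.projIcc_of_right_le _ (by linarith)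
    · left
      exact Set.projIcc_of_le_left _ (by linarith)
  linarith

lemma clampCube_coe {i : ℕ} (y : Fin i → unitInterval) :
    clampCube (fun j => 2 * (y j : ℝ) - 1) = y := by
  funext j
  unfold clampCube
  rw [show (2 * (y j : ℝ) - 1 + 1) / 2 = (y j : ℝ) by ring]
  exact Set.projIcc_val _ _

lemma norm_two_mul_sub {i : ℕ} (y : Fin i → unitInterval) :
    ‖(fun j => 2 * (y j : ℝ) - 1 : Fin i → ℝ)‖ ≤ 1 := by
  rw [pi_norm_le_iff_of_nonneg zero_le_one]
  intro j
  rw [Real.norm_eq_abs, abs_le]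
  have := (y j).2
  constructor <;> linarith [this.1, this.2]

lemma norm_boundary {i : ℕ} {y : Fin i → unitInterval} (h : y ∈ Cube.boundary (Fin i)) :
    1 ≤ ‖(fun j => 2 * (y j : ℝ) - 1 : Fin i → ℝ)‖ := by
  obtain ⟨j, hj⟩ := h
  refine le_trans ?_ (norm_le_pi_norm _ j)
  rcases hj with hj | hj <;> rw [hj] <;> norm_num

lemma isConn_of_setConn {α : Type*} [Fintype α] {K : Finset α → Prop} {n : ℤ}
    (h : SetConn n (rz K)) : IsConn n (SReal K) := by
  constructor
  · intro hn
    obtain ⟨G, -, hG, -⟩ := h 0 (by simpa using by linarith) 0 continuousOn_const (by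
      intro x hx
      rw [mem_sphere, dist_zero_right, Subsingleton.elim x 0, norm_zero] at hx
      norm_num at hx)
    exact ⟨⟨G 0, hG (by simp)⟩⟩
  · intro i hi x
    have key : ∀ γ : GenLoop (Fin i) (SReal K) x, GenLoop.Homotopic γ GenLoop.const := by
      intro γ
      have hs : IsClosed {w : Fin (i+1) → ℝ | w 0 = 1} :=
        isClosed_eq (by fun_prop) continuous_const
      have htail : Continuous (fun w : Fin (i+1) → ℝ => Fin.tail w) :=
        continuous_pi fun j => continuous_apply _
      have ht : IsClosed {w : Fin (i+1) → ℝ | w 0 = -1 ∨ 1 ≤ ‖Fin.tail w‖} := by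
        refine IsClosed.union (isClosed_eq (by fun_prop) continuous_const) ?_
        exact isClosed_le continuous_const htail.norm
      obtain ⟨k, hk, hks, hkt⟩ := glue hs ht
        (f := fun w => (γ.1 (clampCube (Fin.tail w)) : α → ℝ)) (g := fun _ => (x : α → ℝ))
        (Continuous.continuousOn (continuous_subtype_val.comp
          (γ.1.continuous.comp (continuous_clampCube.comp htail)))) continuousOn_const (by
          intro w hw1 hw2
          rw [mem_ofPred_eq] at hw1 hw2
          have : 1 ≤ ‖Fin.tail w‖ := by
            rcases hw2 with h | h
            · rw [hw1] at h; norm_num at h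
            · exact h
          rw [γ.2 _ (clampCube_boundary this)])
      have hcov : sphere (0 : Fin (i+1) → ℝ) 1 ⊆
          {w : Fin (i+1) → ℝ | w 0 = 1} ∪ {w : Fin (i+1) → ℝ | w 0 = -1 ∨ 1 ≤ ‖Fin.tail w‖} := by
        intro w hw
        have e : ‖w‖ = 1 := by simpa using hw
        rw [norm_fin_succ] at e
        by_cases h' : 1 ≤ ‖Fin.tail w‖
        · right; right; exact h'
        · have h1 : |w 0| = 1 := by
            rcases max_choice |w 0| ‖Fin.tail w‖ with h2 | h2
            · rw [← h2, e]
            · rw [h2] at e; exact absurd e.ge h'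
          rcases eq_or_eq_neg_of_abs_eq h1 with h2 | h2
          · left; exact h2
          · right; left; exact h2
      obtain ⟨G, hG, hGM, hGe⟩ := h (i+1) (by push_cast; linarith) k (hk.mono hcov) (by
        intro w hw
        rcases hcov hw with h | h
        · rw [hks h]; exact (γ.1 _).2
        · rw [hkt h]; exact x.2)
      have hpt : ∀ (t : unitInterval) (y : Fin i → unitInterval),
          (Fin.cons (1 - 2 * (t:ℝ)) (fun j => 2 * (y j : ℝ) - 1) : Fin (i+1) → ℝ) ∈
            closedBall (0 : Fin (i+1) → ℝ) 1 := by
        intro t y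
        rw [mem_closedBall, dist_zero_right, norm_fin_succ]
        apply max_le
        · rw [Fin.cons_zero, abs_le]
          constructor <;> linarith [t.2.1, t.2.2]
        · rw [Fin.tail_cons]; exact norm_two_mul_sub y
      have hsph : ∀ w : Fin (i+1) → ℝ, w ∈ closedBall (0 : Fin (i+1) → ℝ) 1 →
          (w 0 = 1 ∨ w 0 = -1 ∨ 1 ≤ ‖Fin.tail w‖) → w ∈ sphere (0 : Fin (i+1) → ℝ) 1 := by
        intro w hw hw'
        rw [mem_closedBall, dist_zero_right] at hw
        rw [mem_sphere, dist_zero_right]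
        refine le_antisymm hw ?_
        rw [norm_fin_succ]
        rcases hw' with h | h | h
        · rw [h]; simp
        · rw [h]; simp
        · exact le_max_of_le_right h
      have hcont : Continuous (fun p : unitInterval × (Fin i → unitInterval) =>
          (⟨G (Fin.cons (1 - 2 * (p.1:ℝ)) (fun j => 2 * (p.2 j : ℝ) - 1)), hGM (hpt p.1 p.2)⟩ :
            SReal K)) := by
        refine Continuous.subtype_mk ?_ _
        refine hG.comp_continuous ?_ (fun p => hpt p.1 p.2)
        refine continuous_pi fun j => ?_
        refine Fin.cases ?_ (fun j => ?_) j
        · simp only [Fin.cons_zero]; fun_prop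
        · simp only [Fin.cons_succ]; fun_prop
      refine ⟨⟨⟨⟨_, hcont⟩, ?_, ?_⟩, ?_⟩⟩
      · intro y
        apply Subtype.ext
        show G _ = _
        rw [hGe (hsph _ (hpt 0 y) (Or.inl (by simp))), hks (by simp)]
        beta_reduce
        rw [Fin.tail_cons, clampCube_coe]
      · intro y
        apply Subtype.ext
        show G _ = _
        rw [hGe (hsph _ (hpt 1 y) (Or.inr (Or.inl (by simp; norm_num)))),
          hkt (Or.inl (by simp; norm_num))]
        rfl
      · intro t y hy
        apply Subtype.ext
        show G _ = _
        have : 1 ≤ ‖Fin.tail (Fin.cons (1 - 2 * (t:ℝ)) (fun j => 2 * (y j : ℝ) - 1) :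
            Fin (i+1) → ℝ)‖ := by
          rw [Fin.tail_cons]; exact norm_boundary hy
        rw [hGe (hsph _ (hpt t y) (Or.inr (Or.inr this))), hkt (Or.inr this)]
        exact (congrArg Subtype.val (γ.2 y hy)).symm
    refine ⟨fun a b => ?_⟩
    induction a using Quotient.inductionOn
    induction b using Quotient.inductionOn
    exact Quotient.sound ((key _).trans (key _).symm)

end QF

namespace QF

/-- Auxiliary collapse parameter. -/
def rho {i : ℕ} (w : Fin (i+1) → ℝ) : ℝ := min 1 (‖Fin.tail w‖ + (1 - w 0))

/-- Collapse of the complement of the top face to the south pole (unnormalized). -/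
def kap {i : ℕ} (w : Fin (i+1) → ℝ) : Fin (i+1) → ℝ :=
  Fin.cons (1 - 2 * rho w) ((1 - rho w) • Fin.tail w)

lemma continuous_tail' {i : ℕ} : Continuous (fun w : Fin (i+1) → ℝ => Fin.tail w) :=
  continuous_pi fun _ => continuous_apply _

lemma continuous_rho {i : ℕ} : Continuous (rho (i := i)) := by
  unfold rho
  have := continuous_tail' (i := i)
  fun_prop

lemma continuous_kap {i : ℕ} : Continuous (kap (i := i)) := by
  have h1 := continuous_rho (i := i)
  refine continuous_pi fun j => ?_
  refine Fin.cases ?_ (fun j => ?_) j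
  · simp only [kap, Fin.cons_zero]; fun_prop
  · simp only [kap, Fin.cons_succ, Pi.smul_apply, Fin.tail]; fun_prop

lemma sphere_cases {i : ℕ} {w : Fin (i+1) → ℝ} (hw : w ∈ sphere (0 : Fin (i+1) → ℝ) 1) :
    w 0 = 1 ∨ w 0 = -1 ∨ 1 ≤ ‖Fin.tail w‖ := by
  have e : ‖w‖ = 1 := by simpa using hw
  rw [norm_fin_succ] at e
  by_cases h' : 1 ≤ ‖Fin.tail w‖
  · right; right; exact h'
  · have h1 : |w 0| = 1 := by
      rcases max_choice |w 0| ‖Fin.tail w‖ with h2 | h2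
      · rw [← h2, e]
      · rw [h2] at e; exact absurd e.ge h'
    rcases eq_or_eq_neg_of_abs_eq h1 with h2 | h2
    · left; exact h2
    · right; left; exact h2

lemma path_ne_zero {i : ℕ} {w : Fin (i+1) → ℝ} (hw : w ∈ sphere (0 : Fin (i+1) → ℝ) 1) {t : ℝ}
    (ht : t ∈ Icc (0:ℝ) 1) : (1 - t) • w + t • kap w ≠ 0 := by
  intro h
  have e : ‖w‖ = 1 := by simpa using hw
  have h0 : (1 - t) * w 0 + t * (1 - 2 * rho w) = 0 := by
    have := congrFun h 0
    simpa [kap] using this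
  have hv : ∀ j : Fin i, (1 - t * rho w) * Fin.tail w j = 0 := by
    intro j
    have := congrFun h j.succ
    simp only [kap, Pi.add_apply, Pi.smul_apply, Fin.cons_succ, smul_eq_mul, Pi.zero_apply] at this
    simp only [Fin.tail] at this ⊢
    linarith
  have hr1 : rho w ≤ 1 := min_le_left _ _
  have hw0 : |w 0| ≤ 1 := by rw [← e, norm_fin_succ]; exact le_max_left _ _
  rw [abs_le] at hw0
  have hr0 : 0 ≤ rho w := by
    refine le_min zero_le_one ?_
    have := norm_nonneg (Fin.tail w)
    linarith
  by_cases hc : 1 - t * rho w = 0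
  · have ht1 : t = 1 := by nlinarith [ht.1, ht.2]
    subst ht1
    have : rho w = 1 := by linarith
    rw [this] at h0; norm_num at h0
  · have hv0 : Fin.tail w = 0 := by
      funext j
      have := hv j
      simpa [hc] using this
    rcases sphere_cases hw with h1 | h1 | h1
    · have : rho w = 0 := by simp [rho, hv0, h1]
      rw [this, h1] at h0; norm_num at h0
    · have : rho w = 1 := by simp [rho, hv0, h1]
      rw [this, h1] at h0; linarith
    · rw [hv0, norm_zero] at h1; linarith

/-- Normalization. -/
def nrm {m : ℕ} (u : Fin m → ℝ) : Fin m → ℝ := ‖u‖⁻¹ • u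

lemma nrm_mem {m : ℕ} {u : Fin m → ℝ} (h : u ≠ 0) : nrm u ∈ sphere (0 : Fin m → ℝ) 1 := by
  rw [mem_sphere, dist_zero_right, nrm, norm_smul, norm_inv, norm_norm,
    inv_mul_cancel₀ (norm_ne_zero_iff.2 h)]

lemma nrm_of_mem {m : ℕ} {u : Fin m → ℝ} (h : u ∈ sphere (0 : Fin m → ℝ) 1) : nrm u = u := by
  have e : ‖u‖ = 1 := by simpa using h
  simp [nrm, e]

lemma continuousOn_nrm {m : ℕ} : ContinuousOn (nrm (m := m)) {u | u ≠ 0} := by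
  unfold nrm
  refine ContinuousOn.fun_smul (continuous_norm.continuousOn.inv₀ ?_) continuousOn_id
  intro x hx
  exact norm_ne_zero_iff.2 hx

lemma kap_south {i : ℕ} {w : Fin (i+1) → ℝ} (h : rho w = 1) :
    kap w = Fin.cons (-1) 0 := by
  rw [kap, h]; norm_num

lemma south_mem {i : ℕ} : (Fin.cons (-1) 0 : Fin (i+1) → ℝ) ∈ sphere (0 : Fin (i+1) → ℝ) 1 := by
  rw [mem_sphere, dist_zero_right, norm_fin_succ]
  simp

lemma setConn_of_isConn {α : Type*} [Fintype α] {K : Finset α → Prop} {n : ℤ}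
    (h : IsConn n (SReal K)) : SetConn n (rz K) := by
  intro m hm g hg hgM
  obtain _ | i := m
  · obtain ⟨p⟩ := h.1 (by push_cast at hm; linarith)
    refine ⟨fun _ => p.1, continuousOn_const, fun _ _ => p.2, fun x hx => ?_⟩
    rw [mem_sphere, dist_zero_right, Subsingleton.elim x 0, norm_zero] at hx
    norm_num at hx
  · have hkap : ∀ w ∈ sphere (0 : Fin (i+1) → ℝ) 1, kap w ≠ 0 := by
      intro w hw
      simpa using path_ne_zero hw (t := 1) (by simp)
    have hcomp : ContinuousOn (fun w => g (nrm (kap w))) (sphere (0 : Fin (i+1) → ℝ) 1) :=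
      hg.comp (continuousOn_nrm.comp continuous_kap.continuousOn hkap)
        (fun w hw => nrm_mem (hkap w hw))
    refine fills_of_homotopy (fun p => g (nrm ((1 - p.1) • p.2 + p.1 • kap p.2))) ?_ ?_ ?_ ?_
    · refine hg.comp (continuousOn_nrm.comp ?_ ?_) ?_
      · have := continuous_kap (i := i)
        fun_prop
      · rintro ⟨t, w⟩ ⟨ht, hw⟩
        exact path_ne_zero hw ht
      · rintro ⟨t, w⟩ ⟨ht, hw⟩
        exact nrm_mem (path_ne_zero hw ht)
    · rintro ⟨t, w⟩ ⟨ht, hw⟩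
      exact hgM (nrm_mem (path_ne_zero hw ht))
    · intro w hw
      simp [nrm_of_mem hw]
    · have htop : ∀ y : Fin i → unitInterval,
          (Fin.cons 1 (fun j => 2 * (y j : ℝ) - 1) : Fin (i+1) → ℝ) ∈
            sphere (0 : Fin (i+1) → ℝ) 1 := by
        intro y
        rw [mem_sphere, dist_zero_right, norm_fin_succ, Fin.cons_zero, Fin.tail_cons, abs_one]
        exact max_eq_left (norm_two_mul_sub y)
      set x0 : SReal K := ⟨g (Fin.cons (-1) 0), hgM south_mem⟩ with hx0
      have hc : Continuous (fun y : Fin i → unitInterval =>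
          (⟨g (nrm (kap (Fin.cons 1 (fun j => 2 * (y j : ℝ) - 1)))),
            hgM (nrm_mem (hkap _ (htop y)))⟩ : SReal K)) := by
        refine Continuous.subtype_mk ?_ _
        refine hcomp.comp_continuous ?_ htop
        refine continuous_pi fun j => ?_
        refine Fin.cases ?_ (fun j => ?_) j
        · simp only [Fin.cons_zero]; fun_prop
        · simp only [Fin.cons_succ]; fun_prop
      have hb : (⟨_, hc⟩ : C(Fin i → unitInterval, SReal K)) ∈ GenLoop (Fin i) (SReal K) x0 := by
        intro y hy
        apply Subtype.ext
        show g (nrm (kap _)) = g _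
        rw [kap_south, nrm_of_mem south_mem]
        simp only [rho, Fin.tail_cons, Fin.cons_zero, sub_self, add_zero]
        exact min_eq_left (norm_boundary hy)
      have hsub := h.2 i (by push_cast at hm; linarith) x0
      have hq : (Quotient.mk (GenLoop.Homotopic.setoid (Fin i) x0) ⟨_, hb⟩ :
          HomotopyGroup (Fin i) (SReal K) x0) = Quotient.mk _ GenLoop.const :=
        @Subsingleton.elim (HomotopyGroup (Fin i) (SReal K) x0) hsub _ _
      obtain ⟨H⟩ : GenLoop.Homotopic _ _ := Quotient.exact hq
      have hw1 : ∀ w ∈ closedBall (0 : Fin (i+1) → ℝ) 1, |w 0| ≤ 1 := by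
        intro w hw
        rw [mem_closedBall, dist_zero_right, norm_fin_succ] at hw
        exact (le_max_left _ _).trans hw
      refine ⟨fun w => (H (Set.projIcc 0 1 zero_le_one ((1 - w 0) / 2),
        clampCube (Fin.tail w)) : SReal K).1, ?_, ?_, ?_⟩
      · refine Continuous.continuousOn (continuous_subtype_val.comp (H.continuous.comp ?_))
        refine Continuous.prodMk (continuous_projIcc.comp (by fun_prop))
          (continuous_clampCube.comp continuous_tail')
      · intro w hw
        exact (H _ : SReal K).2
      · intro w hw
        have hwb := hw1 w (sphere_subset_closedBall hw)
        rw [abs_le] at hwb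
        simp only [sub_self, zero_smul, one_smul, zero_add]
        rcases sphere_cases hw with h1 | h1 | h1
        · have e1 : Set.projIcc (0:ℝ) 1 zero_le_one ((1 - w 0) / 2) = 0 := by
            rw [h1]; exact Set.projIcc_of_le_left _ (by norm_num)
          rw [e1, H.apply_zero]
          show g (nrm (kap _)) = _
          congr 3
          funext j
          refine Fin.cases ?_ (fun j => ?_) j
          · simp [h1]
          · simp only [Fin.cons_succ, clampCube, Fin.tail]
            have hj : |w j.succ| ≤ 1 := by
              have e : ‖w‖ = 1 := by simpa using hw
              rw [← e]; exact norm_le_pi_norm w j.succ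
            rw [abs_le] at hj
            rw [Set.projIcc_of_mem _ ⟨by linarith, by linarith⟩]
            simp only; ring
        · have e1 : Set.projIcc (0:ℝ) 1 zero_le_one ((1 - w 0) / 2) = 1 := by
            rw [h1]; exact Set.projIcc_of_right_le _ (by norm_num)
          rw [e1, H.apply_one]
          show g _ = _
          rw [kap_south, nrm_of_mem south_mem]
          have := norm_nonneg (Fin.tail w)
          rw [rho, h1]
          exact min_eq_left (by linarith)
        · rw [H.eq_fst _ (clampCube_boundary h1)]
          show g (nrm (kap _)) = _
          have e2 := congrArg Subtype.val (hb _ (clampCube_boundary h1))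
          have e3 : g (nrm (kap w)) = g (Fin.cons (-1) 0) := by
            rw [kap_south, nrm_of_mem south_mem]
            rw [rho]
            exact min_eq_left (by linarith)
          rw [e3]
          exact e2

end QF

namespace QF

/-- closed geometric simplex -/
def spx {α : Type*} [Fintype α] (σ : Finset α) : Set (α → ℝ) :=
  {z | (∀ a, 0 ≤ z a) ∧ (∑ a, z a) = 1 ∧ ∀ a, z a ≠ 0 → a ∈ σ}

lemma isClosed_spx {α : Type*} [Fintype α] (σ : Finset α) : IsClosed (spx σ) := by
  have : spx σ = (⋂ a, {z : α → ℝ | 0 ≤ z a}) ∩ ({z : α → ℝ | ∑ a, z a = 1} ∩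
      ⋂ a, ⋂ (_ : a ∉ σ), {z : α → ℝ | z a = 0}) := by
    ext z
    simp only [spx, mem_ofPred_eq, mem_inter_iff, mem_iInter]
    refine and_congr_right fun _ => and_congr_right fun _ => ?_
    exact forall_congr' fun a => by tauto
  rw [this]
  refine (isClosed_iInter fun a => isClosed_le (by fun_prop) (by fun_prop)).inter
    ((isClosed_eq (by fun_prop) (by fun_prop)).inter
    (isClosed_iInter fun a => isClosed_iInter fun _ => isClosed_eq (by fun_prop) (by fun_prop)))

lemma rz_eq {α : Type*} [Fintype α] (K : Finset α → Prop) :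
    rz K = ⋃ σ ∈ {σ | K σ}, spx σ := by
  ext z
  simp only [rz, spx, mem_ofPred_eq, mem_iUnion]
  constructor
  · rintro ⟨h1, h2, σ, h3, h4⟩
    exact ⟨σ, h3, h1, h2, h4⟩
  · rintro ⟨σ, h3, h1, h2, h4⟩
    exact ⟨h1, h2, σ, h3, h4⟩

lemma isClosed_rz {α : Type*} [Fintype α] (K : Finset α → Prop) : IsClosed (rz K) := by
  classical
  rw [rz_eq]
  exact (Set.toFinite _).isClosed_biUnion fun σ _ => isClosed_spx σ

/-- corner simplex -/
def corner (m : ℕ) : Set (Fin m → ℝ) := {x | (∀ i, 0 ≤ x i) ∧ ∑ i, x i ≤ 1}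

lemma isClosed_corner (m : ℕ) : IsClosed (corner m) := by
  have : corner m = (⋂ a, {z : Fin m → ℝ | 0 ≤ z a}) ∩ {z : Fin m → ℝ | ∑ a, z a ≤ 1} := by
    ext z; simp [corner]
  rw [this]
  exact (isClosed_iInter fun a => isClosed_le (by fun_prop) (by fun_prop)).inter
    (isClosed_le (by fun_prop) (by fun_prop))

lemma convex_corner (m : ℕ) : Convex ℝ (corner m) := by
  intro x hx y hy a b ha hb hab
  refine ⟨fun i => ?_, ?_⟩
  · have := hx.1 i
    have := hy.1 i
    simp only [Pi.add_apply, Pi.smul_apply, smul_eq_mul]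
    positivity
  · simp only [Pi.add_apply, Pi.smul_apply, smul_eq_mul, Finset.sum_add_distrib, ← Finset.mul_sum]
    nlinarith [hx.2, hy.2]

lemma mem_interior_corner {m : ℕ} {x : Fin m → ℝ} :
    x ∈ interior (corner m) ↔ (∀ i, 0 < x i) ∧ ∑ i, x i < 1 := by
  constructor
  · intro hx
    rw [mem_interior_iff_mem_nhds, Metric.mem_nhds_iff] at hx
    obtain ⟨ε, hε, hb⟩ := hx
    have h1 : (fun i => x i - ε / 2) ∈ corner m := by
      apply hb
      rw [mem_ball, dist_pi_lt_iff hε]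
      intro i
      rw [Real.dist_eq]
      rw [show x i - ε / 2 - x i = -(ε/2) by ring, abs_neg, abs_of_pos (by linarith)]
      linarith
    have h2 : (fun i => x i + ε / 2) ∈ corner m := by
      apply hb
      rw [mem_ball, dist_pi_lt_iff hε]
      intro i
      rw [Real.dist_eq]
      rw [show x i + ε / 2 - x i = (ε/2) by ring, abs_of_pos (by linarith)]
      linarith
    refine ⟨fun i => ?_, ?_⟩
    · have := h1.1 i
      simp only at this
      linarith
    · have h3 := h2.2
      rw [Finset.sum_add_distrib, Finset.sum_const, Finset.card_univ, Fintype.card_fin] at h3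
      rcases Nat.eq_zero_or_pos m with h0 | h0
      · subst h0; simp
      · have : (1:ℝ) ≤ m := by exact_mod_cast h0
        rw [nsmul_eq_mul] at h3
        nlinarith
  · rintro ⟨h1, h2⟩
    have ho : IsOpen ((⋂ a, {z : Fin m → ℝ | 0 < z a}) ∩ {z : Fin m → ℝ | ∑ a, z a < 1}) :=
      (isOpen_iInter_of_finite fun a => isOpen_lt (by fun_prop) (by fun_prop)).inter
        (isOpen_lt (by fun_prop) (by fun_prop))
    refine interior_maximal ?_ ho ⟨by simpa using h1, h2⟩
    rintro z ⟨hz1, hz2⟩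
    simp only [mem_iInter, mem_ofPred_eq] at hz1 hz2
    exact ⟨fun i => (hz1 i).le, hz2.le⟩

lemma corner_homeo (m : ℕ) : ∃ h : (Fin m → ℝ) ≃ₜ (Fin m → ℝ),
    h '' corner m = closedBall 0 1 ∧ h '' frontier (corner m) = sphere 0 1 := by
  obtain ⟨h, -, h2, h3⟩ := exists_homeomorph_image_interior_closure_frontier_eq_unitBall
    (convex_corner m) ⟨fun _ => 1 / ((m:ℝ) + 1), by
      rw [mem_interior_corner]
      refine ⟨fun i => by positivity, ?_⟩
      rw [Finset.sum_const, Finset.card_univ, Fintype.card_fin, nsmul_eq_mul, mul_one_div,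
        div_lt_one (by positivity)]
      linarith⟩
    ((isBounded_closedBall (x := (0 : Fin m → ℝ)) (r := 1)).subset (by
      intro x hx
      rw [mem_closedBall, dist_zero_right, pi_norm_le_iff_of_nonneg zero_le_one]
      intro i
      rw [Real.norm_eq_abs, abs_of_nonneg (hx.1 i)]
      exact (Finset.single_le_sum (fun j _ => hx.1 j) (Finset.mem_univ i)).trans hx.2))
  rw [(isClosed_corner m).closure_eq] at h2
  exact ⟨h, h2, h3⟩

lemma simplex_extend {α : Type*} [Fintype α] {V : Type*} [TopologicalSpace V] {Y : Set V}
    {n : ℤ} (hY : SetConn n Y) (σ : Finset α) {m : ℕ} (hσ : σ.card = m + 1)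
    (hm : (m : ℤ) ≤ n + 1) (f : (α → ℝ) → V)
    (hf : ContinuousOn f {z | z ∈ spx σ ∧ ∃ a ∈ σ, z a = 0})
    (hfM : MapsTo f {z | z ∈ spx σ ∧ ∃ a ∈ σ, z a = 0} Y) :
    ∃ F : (α → ℝ) → V, ContinuousOn F (spx σ) ∧ MapsTo F (spx σ) Y ∧
      EqOn F f {z | z ∈ spx σ ∧ ∃ a ∈ σ, z a = 0} := by
  classical
  obtain ⟨h, h1, h2⟩ := corner_homeo m
  let e : σ ≃ Fin (m+1) := σ.equivFinOfCardEq hσ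
  let j : (Fin m → ℝ) → (α → ℝ) := fun x a =>
    if ha : a ∈ σ then (Fin.cons (1 - ∑ i, x i) x : Fin (m+1) → ℝ) (e ⟨a, ha⟩) else 0
  let p : (α → ℝ) → (Fin m → ℝ) := fun z i => z (e.symm i.succ)
  have hjc : Continuous j := by
    refine continuous_pi fun a => ?_
    by_cases ha : a ∈ σ
    · simp only [j, ha, dif_pos]
      generalize e ⟨a, ha⟩ = k
      refine Fin.cases ?_ (fun i => ?_) k
      · simp only [Fin.cons_zero]; fun_prop
      · simp only [Fin.cons_succ]; fun_prop
    · simp only [j, ha, dif_neg, not_false_eq_true]; fun_prop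
  have hpc : Continuous p := continuous_pi fun i => continuous_apply _
  have hsum : ∀ z : α → ℝ, (∀ a, z a ≠ 0 → a ∈ σ) →
      ∑ a, z a = z (e.symm 0) + ∑ i : Fin m, z (e.symm i.succ) := by
    intro z hz
    rw [← Fin.sum_univ_succ (fun i => z (e.symm i)), Equiv.sum_comp e.symm (fun a : σ => z a),
      Finset.sum_coe_sort σ z]
    symm
    apply Finset.sum_subset (Finset.subset_univ _)
    intro a _ ha
    by_contra hc
    exact ha (hz a hc)
  have hjp : ∀ z ∈ spx σ, j (p z) = z := by
    rintro z ⟨hz0, hz1, hz2⟩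
    funext a
    by_cases ha : a ∈ σ
    · simp only [j, ha, dif_pos]
      obtain ⟨k, hk⟩ : ∃ k, e ⟨a, ha⟩ = k := ⟨_, rfl⟩
      have hk' : a = (e.symm k : α) := by rw [← hk]; simp
      rw [hk, hk']
      rw [hsum z hz2] at hz1
      refine Fin.cases ?_ (fun i => ?_) k
      · simp only [Fin.cons_zero, p]; linarith
      · simp only [Fin.cons_succ, p]
    · simp only [j, ha, dif_neg, not_false_eq_true]
      by_contra hc
      exact ha (hz2 a (Ne.symm hc))
  have hpM : ∀ z ∈ spx σ, p z ∈ corner m := by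
    rintro z ⟨hz0, hz1, hz2⟩
    refine ⟨fun i => hz0 _, ?_⟩
    rw [hsum z hz2] at hz1
    have := hz0 (e.symm 0)
    simp only [p]; linarith
  have hpF : ∀ z ∈ spx σ, (∃ a ∈ σ, z a = 0) → p z ∈ frontier (corner m) := by
    rintro z hz ⟨a, ha, hza⟩
    rw [(isClosed_corner m).frontier_eq]
    refine ⟨hpM z hz, ?_⟩
    rw [mem_interior_corner]
    rintro ⟨hi1, hi2⟩
    obtain ⟨k, hk⟩ : ∃ k, e ⟨a, ha⟩ = k := ⟨_, rfl⟩
    have hk' : a = (e.symm k : α) := by rw [← hk]; simp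
    obtain ⟨hz0, hz1, hz2⟩ := hz
    rw [hsum z hz2] at hz1
    rw [hk'] at hza
    revert hza
    refine Fin.cases ?_ (fun i => ?_) k
    · intro hza
      simp only [p] at hi2
      linarith
    · intro hza
      have := hi1 i
      simp only [p] at this
      linarith
  have hjF : ∀ x ∈ frontier (corner m), j x ∈ {z | z ∈ spx σ ∧ ∃ a ∈ σ, z a = 0} := by
    intro x hx
    rw [(isClosed_corner m).frontier_eq] at hx
    obtain ⟨⟨hx0, hx1⟩, hx2⟩ := hx
    have hje : ∀ k, j x (e.symm k) = (Fin.cons (1 - ∑ i, x i) x : Fin (m+1) → ℝ) k := by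
      intro k
      simp [j]
    have hsupp : ∀ a, j x a ≠ 0 → a ∈ σ := by
      intro a ha
      by_contra hc
      exact ha (by simp [j, hc])
    refine ⟨⟨?_, ?_, hsupp⟩, ?_⟩
    · intro a
      by_cases ha : a ∈ σ
      · simp only [j, ha, dif_pos]
        generalize e ⟨a, ha⟩ = k
        refine Fin.cases ?_ (fun i => ?_) k
        · simp only [Fin.cons_zero]; linarith
        · simp only [Fin.cons_succ]; exact hx0 i
      · simp [j, ha]
    · rw [hsum _ hsupp]
      simp only [hje, Fin.cons_zero, Fin.cons_succ]
      ring
    · rw [mem_interior_corner, not_and_or] at hx2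
      rcases hx2 with hx2 | hx2
      · push Not at hx2
        obtain ⟨i, hi⟩ := hx2
        refine ⟨e.symm i.succ, (e.symm i.succ).2, ?_⟩
        rw [hje, Fin.cons_succ]
        exact le_antisymm hi (hx0 i)
      · refine ⟨e.symm 0, (e.symm 0).2, ?_⟩
        rw [hje, Fin.cons_zero]
        linarith
  have hsm : ∀ w ∈ sphere (0 : Fin m → ℝ) 1, h.symm w ∈ frontier (corner m) := by
    intro w hw
    rw [← h2] at hw
    obtain ⟨x, hx, rfl⟩ := hw
    simpa using hx
  obtain ⟨G, hG, hGM, hGe⟩ := hY m hm (fun w => f (j (h.symm w)))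
    (hf.comp (hjc.comp h.symm.continuous).continuousOn (fun w hw => hjF _ (hsm w hw)))
    (fun w hw => hfM (hjF _ (hsm w hw)))
  have hb : ∀ z ∈ spx σ, h (p z) ∈ closedBall (0 : Fin m → ℝ) 1 := by
    intro z hz
    rw [← h1]
    exact mem_image_of_mem _ (hpM z hz)
  refine ⟨fun z => G (h (p z)), hG.comp (h.continuous.comp hpc).continuousOn hb,
    fun z hz => hGM (hb z hz), ?_⟩
  rintro z ⟨hz, hz'⟩
  have : h (p z) ∈ sphere (0 : Fin m → ℝ) 1 := by
    rw [← h2]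
    exact mem_image_of_mem _ (hpF z hz hz')
  show G (h (p z)) = f z
  rw [hGe this]
  simp [hjp z hz]

/-- Extension over finitely many additional faces of small dimension. -/
lemma extend {α : Type*} [Fintype α] {V : Type*} [TopologicalSpace V] {Y : Set V}
    {n : ℤ} (hY : SetConn n Y) {K : Finset α → Prop}
    (hK : ∀ σ τ, K σ → τ ⊆ σ → τ.Nonempty → K τ) (f : (α → ℝ) → V)
    (hf : ContinuousOn f (rz K)) (hfM : MapsTo f (rz K) Y) (s : Finset (Finset α)) :
    (∀ σ ∈ s, σ.Nonempty ∧ (σ.card : ℤ) ≤ n + 2 ∧ ¬ K σ) →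
    (∀ σ ∈ s, ∀ τ ⊂ σ, τ.Nonempty → K τ ∨ τ ∈ s) →
    ∃ F : (α → ℝ) → V, ContinuousOn F (rz (fun τ => K τ ∨ τ ∈ s)) ∧
      MapsTo F (rz (fun τ => K τ ∨ τ ∈ s)) Y ∧ EqOn F f (rz K) := by
  classical
  refine Finset.induction_on_max_value (fun σ : Finset α => σ.card) s ?_ ?_
  · intro _ _
    refine ⟨f, ?_, ?_, fun _ _ => rfl⟩ <;> simpa using by assumption
  · intro σ s hσs hmax ih hs hcl
    obtain ⟨F', hF', hFM', hFe'⟩ := ih (fun τ hτ => hs τ (Finset.mem_insert_of_mem hτ)) (by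
      intro σ' hσ' τ hτ hne
      rcases hcl σ' (Finset.mem_insert_of_mem hσ') τ hτ hne with h | h
      · exact Or.inl h
      · rcases Finset.mem_insert.1 h with h | h
        · exfalso
          have := hmax σ' hσ'
          have := Finset.card_lt_card hτ
          rw [h] at this
          omega
        · exact Or.inr h)
    obtain ⟨hne, hcard, hnK⟩ := hs σ (Finset.mem_insert_self _ _)
    obtain ⟨m, hm⟩ : ∃ m, σ.card = m + 1 := ⟨σ.card - 1, by have := hne.card_pos; omega⟩
    have hbd : {z | z ∈ spx σ ∧ ∃ a ∈ σ, z a = 0} ⊆ rz (fun τ => K τ ∨ τ ∈ s) := by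
      rintro z ⟨⟨hz0, hz1, hz2⟩, a, ha, hza⟩
      refine ⟨hz0, hz1, Finset.univ.filter (fun a => z a ≠ 0), ?_, by simp⟩
      have hsub : Finset.univ.filter (fun a => z a ≠ 0) ⊂ σ := by
        rw [Finset.ssubset_iff_of_subset (fun b hb => hz2 b (by simpa using hb))]
        exact ⟨a, ha, by simp [hza]⟩
      have hne' : (Finset.univ.filter (fun a => z a ≠ 0)).Nonempty := by
        by_contra hc
        rw [Finset.not_nonempty_iff_eq_empty, Finset.filter_eq_empty_iff] at hc
        rw [Finset.sum_eq_zero (fun b hb => by simpa using hc hb)] at hz1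
        norm_num at hz1
      rcases hcl σ (Finset.mem_insert_self _ _) _ hsub hne' with h | h
      · exact Or.inl h
      · rcases Finset.mem_insert.1 h with h | h
        · exact absurd h hsub.ne
        · exact Or.inr h
    obtain ⟨G, hG, hGM, hGe⟩ := simplex_extend hY σ hm (by omega) F' (hF'.mono hbd)
      (hFM'.mono_left hbd)
    obtain ⟨k, hk, hk1, hk2⟩ := glue (isClosed_rz (fun τ => K τ ∨ τ ∈ s)) (isClosed_spx σ)
      hF' hG (by
        rintro z ⟨hz0, hz1, τ, hτ, hzτ⟩ hzσ
        refine (hGe ⟨hzσ, ?_⟩).symm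
        by_contra hc
        push Not at hc
        have hsub : σ ⊆ τ := fun a ha => hzτ a (hc a ha)
        rcases hτ with hτ | hτ
        · exact hnK (hK τ σ hτ hsub hne)
        · have h1 := hmax τ hτ
          have := Finset.eq_of_subset_of_card_le hsub h1
          rw [this] at hσs
          exact hσs hτ)
    have hcov : rz (fun τ => K τ ∨ τ ∈ insert σ s) ⊆ rz (fun τ => K τ ∨ τ ∈ s) ∪ spx σ := by
      rintro z ⟨hz0, hz1, τ, hτ, hzτ⟩
      rw [Finset.mem_insert] at hτ
      rcases hτ with hτ | hτ | hτ
      · left; exact ⟨hz0, hz1, τ, Or.inl hτ, hzτ⟩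
      · subst hτ
        right; exact ⟨hz0, hz1, hzτ⟩
      · left; exact ⟨hz0, hz1, τ, Or.inr hτ, hzτ⟩
    refine ⟨k, hk.mono hcov, ?_, ?_⟩
    · intro z hz
      rcases hcov hz with h | h
      · rw [hk1 h]; exact hFM' h
      · rw [hk2 h]; exact hGM h
    · rintro z hz
      rw [hk1 (by
        obtain ⟨hz0, hz1, τ, hτ, hzτ⟩ := hz
        exact ⟨hz0, hz1, τ, Or.inl hτ, hzτ⟩)]
      exact hFe' hz

end QF

namespace QF

lemma kuhn_card {m : ℕ} (y : Fin m → ℝ) (C : Finset (Fin m → ℤ))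
    (hC : ∀ v ∈ C, ∀ i j, (y i - v i) + (v j - y j) < 1)
    (hC1 : ∀ v ∈ C, ∀ i, y i - v i < 1) (hC2 : ∀ v ∈ C, ∀ i, v i - y i < 1) :
    C.card ≤ m + 1 ∧ ((∃ i, ∃ k : ℤ, y i = k) → C.card ≤ m) := by
  have hlo : ∀ v ∈ C, ∀ i, 0 ≤ v i - ⌊y i⌋ := by
    intro v hv i
    have h1 := hC1 v hv i
    have h2 := Int.floor_le (y i)
    have : ((⌊y i⌋ - 1 : ℤ) : ℝ) < v i := by push_cast; linarith
    have := Int.cast_lt.1 this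
    omega
  have hhi : ∀ v ∈ C, ∀ i, v i - ⌊y i⌋ ≤ 1 := by
    intro v hv i
    have h1 := hC2 v hv i
    have h2 := Int.lt_floor_add_one (y i)
    have : (v i : ℝ) < ((⌊y i⌋ + 2 : ℤ) : ℝ) := by push_cast; linarith
    have := Int.cast_lt.1 this
    omega
  have hchain : ∀ v ∈ C, ∀ w ∈ C, (∀ i, v i ≤ w i) ∨ (∀ i, w i ≤ v i) := by
    intro v hv w hw
    by_contra hc
    push Not at hc
    obtain ⟨⟨i, hi⟩, ⟨j, hj⟩⟩ := hc
    have h1 := hC v hv j i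
    have h2 := hC w hw i j
    have h3 : ((w i + 1 : ℤ) : ℝ) ≤ v i := by exact_mod_cast hi
    have h4 : ((v j + 1 : ℤ) : ℝ) ≤ w j := by exact_mod_cast hj
    push_cast at h3 h4
    linarith
  have hinj : Set.InjOn (fun v : Fin m → ℤ => ∑ i, (v i - ⌊y i⌋)) C := by
    intro v hv w hw h
    simp only [Finset.sum_sub_distrib, sub_left_inj] at h
    rcases hchain v hv w hw with h1 | h1
    · have := (Finset.sum_eq_sum_iff_of_le (fun i _ => h1 i)).1 h
      funext i; exact this i (Finset.mem_univ i)
    · have := (Finset.sum_eq_sum_iff_of_le (fun i _ => h1 i)).1 h.symm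
      funext i; exact (this i (Finset.mem_univ i)).symm
  constructor
  · have := Finset.card_le_card_of_injOn (t := Finset.Icc (0:ℤ) m) _ (by
      intro v hv
      simp only [Finset.coe_Icc, mem_Icc]
      refine ⟨Finset.sum_nonneg fun i _ => hlo v hv i, ?_⟩
      refine (Finset.sum_le_sum fun i _ => hhi v hv i).trans ?_
      simp) hinj
    rw [Int.card_Icc] at this
    omega
  · rintro ⟨i0, k, hk⟩
    have := Finset.card_le_card_of_injOn (t := Finset.Icc (0:ℤ) (m - 1)) _ (by
      intro v hv
      simp only [Finset.coe_Icc, mem_Icc]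
      refine ⟨Finset.sum_nonneg fun i _ => hlo v hv i, ?_⟩
      rw [← Finset.add_sum_erase _ _ (Finset.mem_univ i0)]
      have h0 : v i0 - ⌊y i0⌋ = 0 := by
        have h1 := hC1 v hv i0
        have h2 := hC2 v hv i0
        rw [hk] at h1 h2 ⊢
        rw [Int.floor_intCast]
        have h3 : ((k - v i0 : ℤ) : ℝ) < ((1:ℤ):ℝ) := by push_cast; linarith
        have h4 : ((v i0 - k : ℤ) : ℝ) < ((1:ℤ):ℝ) := by push_cast; linarith
        have := Int.cast_lt.1 h3
        have := Int.cast_lt.1 h4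
        omega
      rw [h0, zero_add]
      refine (Finset.sum_le_sum fun i _ => hhi v hv i).trans ?_
      rw [Finset.sum_const, Finset.card_erase_of_mem (Finset.mem_univ _), Finset.card_univ,
        Fintype.card_fin]
      have := i0.pos
      simp only [nsmul_eq_mul, mul_one]
      omega) hinj
    rw [Int.card_Icc] at this
    omega

/-- Hat functions of the Kuhn triangulation (before normalization). -/
def hat {m : ℕ} (M : ℕ) (v : Fin m → ℤ) (x : Fin m → ℝ) : ℝ :=
  max 0 (1 - ‖(fun i => max 0 (M * x i - v i) : Fin m → ℝ)‖
    - ‖(fun i => max 0 (v i - M * x i) : Fin m → ℝ)‖)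

lemma continuous_hat {m : ℕ} (M : ℕ) (v : Fin m → ℤ) : Continuous (hat M v) := by
  unfold hat; fun_prop

lemma hat_nonneg {m : ℕ} (M : ℕ) (v : Fin m → ℤ) (x : Fin m → ℝ) : 0 ≤ hat M v x :=
  le_max_left _ _

lemma hat_pos {m : ℕ} {M : ℕ} {v : Fin m → ℤ} {x : Fin m → ℝ} (h : 0 < hat M v x) :
    (∀ i j, (M * x i - v i) + (v j - M * x j) < 1) ∧ (∀ i, M * x i - v i < 1) ∧
      ∀ i, v i - M * x i < 1 := by
  unfold hat at h
  have h' := (lt_max_iff.1 h).resolve_left (lt_irrefl _)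
  have hA : ∀ i, M * x i - v i ≤ ‖(fun i => max 0 (M * x i - v i) : Fin m → ℝ)‖ := fun i =>
    ((le_max_right _ _).trans (le_abs_self _)).trans
      (norm_le_pi_norm (fun i => max 0 (M * x i - v i) : Fin m → ℝ) i)
  have hB : ∀ i, v i - M * x i ≤ ‖(fun i => max 0 (v i - M * x i) : Fin m → ℝ)‖ := fun i =>
    ((le_max_right _ _).trans (le_abs_self _)).trans
      (norm_le_pi_norm (fun i => max 0 (v i - M * x i) : Fin m → ℝ) i)
  have hA0 := norm_nonneg (fun i => max 0 (M * x i - v i) : Fin m → ℝ)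
  have hB0 := norm_nonneg (fun i => max 0 (v i - M * x i) : Fin m → ℝ)
  exact ⟨fun i j => by linarith [hA i, hB j], fun i => by linarith [hA i],
    fun i => by linarith [hB i]⟩

lemma hat_floor_pos {m : ℕ} (M : ℕ) (x : Fin m → ℝ) : 0 < hat M (fun i => ⌊M * x i⌋) x := by
  refine lt_max_of_lt_right ?_
  have h1 : (fun i => max 0 (((fun i => ⌊M * x i⌋ : Fin m → ℤ) i : ℝ) - M * x i) : Fin m → ℝ)
      = 0 := by
    funext i
    exact max_eq_left (by have := Int.floor_le (M * x i); simp only; linarith)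
  rw [h1, norm_zero, sub_zero, sub_pos, pi_norm_lt_iff one_pos]
  intro i
  have h2 := Int.lt_floor_add_one (M * x i)
  rw [Real.norm_eq_abs, abs_of_nonneg (le_max_left _ _)]
  exact max_lt one_pos (by simp only; linarith)

/-- Cellular approximation for maps into a simplicial complex. -/
lemma approx {m : ℕ} {α : Type*} [Fintype α] {Z : Set (Fin m → ℝ)} (hZ : IsCompact Z)
    (hZ1 : Z ⊆ closedBall 0 1) (G : (Fin m → ℝ) → (α → ℝ)) (hG : ContinuousOn G Z)
    (hGs : ∀ x ∈ Z, (∀ a, 0 ≤ G x a) ∧ ∑ a, G x a = 1) :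
    ∃ G' : (Fin m → ℝ) → (α → ℝ), ContinuousOn G' Z ∧ ∀ x ∈ Z,
      (∀ a, 0 ≤ G' x a) ∧ ∑ a, G' x a = 1 ∧ (∀ a, G' x a ≠ 0 → G x a ≠ 0) ∧
      ∃ τ : Finset α, (∀ a, G' x a ≠ 0 → a ∈ τ) ∧ τ.card ≤ m + 1 ∧ (‖x‖ = 1 → τ.card ≤ m) := by
  classical
  rcases Z.eq_empty_or_nonempty with hZe | ⟨z0, hz0⟩
  · subst hZe
    exact ⟨G, hG, fun x hx => absurd hx (by simp)⟩
  have hα : Nonempty α := by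
    by_contra hc
    rw [not_nonempty_iff] at hc
    have := (hGs z0 hz0).2
    simp at this
  have hU : ∀ a : α, ∃ u : Set (Fin m → ℝ), IsOpen u ∧
      G ⁻¹' {z | 0 < z a} ∩ Z = u ∩ Z := fun a =>
    continuousOn_iff'.1 hG _ (isOpen_lt continuous_const (continuous_apply a))
  choose U hUo hUe using hU
  obtain ⟨δ, hδ, hL⟩ := lebesgue_number_lemma_of_metric hZ hUo (by
    intro x hx
    have hs := (hGs x hx).2
    obtain ⟨a, ha⟩ : ∃ a, 0 < G x a := by
      by_contra hc
      push Not at hc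
      have : ∑ a, G x a ≤ 0 := Finset.sum_nonpos fun a _ => hc a
      linarith
    rw [mem_iUnion]
    have : x ∈ G ⁻¹' {z | 0 < z a} ∩ Z := ⟨ha, hx⟩
    rw [hUe] at this
    exact ⟨a, this.1⟩)
  obtain ⟨M, hM⟩ := exists_nat_gt (2 / δ)
  have hM0 : (0:ℝ) < M := lt_of_le_of_lt (by positivity) hM
  have hMδ : 2 < M * δ := by rwa [div_lt_iff₀ hδ] at hM
  have hsel : ∀ v : Fin m → ℤ, ∃ a, ∀ x ∈ Z, 0 < hat M v x → 0 < G x a := by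
    intro v
    by_cases hv : ∃ x ∈ Z, 0 < hat M v x
    · obtain ⟨xv, hxv, hpv⟩ := hv
      obtain ⟨a, ha⟩ := hL xv hxv
      refine ⟨a, fun x hx hpx => ?_⟩
      have hd : x ∈ ball xv δ := by
        rw [mem_ball, dist_pi_lt_iff hδ]
        intro i
        obtain ⟨-, h1, h2⟩ := hat_pos hpv
        obtain ⟨-, h3, h4⟩ := hat_pos hpx
        have h1 := h1 i
        have h2 := h2 i
        have h3 := h3 i
        have h4 := h4 i
        rw [Real.dist_eq, abs_lt]
        constructor <;> by_contra hc <;> push Not at hc <;> nlinarith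
      have : x ∈ G ⁻¹' {z | 0 < z a} ∩ Z := by
        rw [hUe]; exact ⟨ha hd, hx⟩
      exact this.1
    · exact ⟨hα.some, fun x hx hp => absurd ⟨x, hx, hp⟩ hv⟩
  choose c hc using hsel
  let V : Finset (Fin m → ℤ) := Fintype.piFinset fun _ => Finset.Icc (-(M:ℤ)) M
  let S : (Fin m → ℝ) → ℝ := fun x => ∑ v ∈ V, hat M v x
  have hScont : Continuous S := continuous_finsetSum _ fun v _ => continuous_hat M v
  have hSpos : ∀ x ∈ Z, 0 < S x := by
    intro x hx
    have hxb := hZ1 hx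
    rw [mem_closedBall, dist_zero_right] at hxb
    refine Finset.sum_pos' (fun v _ => hat_nonneg M v x) ⟨_, ?_, hat_floor_pos M x⟩
    rw [Fintype.mem_piFinset]
    intro i
    have hi := (norm_le_pi_norm x i).trans hxb
    rw [Real.norm_eq_abs, abs_le] at hi
    rw [Finset.mem_Icc]
    constructor
    · rw [Int.le_floor]; push_cast; nlinarith
    · have : (⌊(M:ℝ) * x i⌋ : ℝ) ≤ ((M:ℤ):ℝ) := by
        refine (Int.floor_le _).trans ?_
        push_cast; nlinarith
      exact_mod_cast this
  refine ⟨fun x b => (S x)⁻¹ * ∑ v ∈ V, if c v = b then hat M v x else 0, ?_, ?_⟩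
  · refine continuousOn_pi.2 fun b => ?_
    refine ContinuousOn.mul (hScont.continuousOn.inv₀ fun x hx => (hSpos x hx).ne') ?_
    refine Continuous.continuousOn (continuous_finsetSum _ fun v _ => ?_)
    split_ifs
    · exact continuous_hat M v
    · exact continuous_const
  · intro x hx
    have hnz : ∀ b, (S x)⁻¹ * (∑ v ∈ V, if c v = b then hat M v x else 0) ≠ 0 →
        ∃ v ∈ V, c v = b ∧ 0 < hat M v x := by
      intro b hb
      obtain ⟨v, hv, hv'⟩ := Finset.exists_ne_zero_of_sum_ne_zero (right_ne_zero_of_mul hb)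
      by_cases hcv : c v = b
      · rw [if_pos hcv] at hv'
        exact ⟨v, hv, hcv, lt_of_le_of_ne (hat_nonneg M v x) hv'.symm⟩
      · rw [if_neg hcv] at hv'; exact absurd rfl hv'
    refine ⟨fun b => ?_, ?_, ?_, ?_⟩
    · refine mul_nonneg (inv_nonneg.2 (hSpos x hx).le) (Finset.sum_nonneg fun v _ => ?_)
      split_ifs
      · exact hat_nonneg M v x
      · exact le_rfl
    · rw [← Finset.mul_sum, Finset.sum_comm]
      simp only [Finset.sum_ite_eq, Finset.mem_univ, if_true]
      exact inv_mul_cancel₀ (hSpos x hx).ne'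
    · intro b hb
      obtain ⟨v, hv, hcv, hp⟩ := hnz b hb
      rw [← hcv]
      exact (hc v x hx hp).ne'
    · have hk := kuhn_card (fun i => M * x i) (V.filter fun v => 0 < hat M v x)
        (fun v hv => (hat_pos (Finset.mem_filter.1 hv).2).1)
        (fun v hv => (hat_pos (Finset.mem_filter.1 hv).2).2.1)
        (fun v hv => (hat_pos (Finset.mem_filter.1 hv).2).2.2)
      refine ⟨(V.filter fun v => 0 < hat M v x).image c, ?_, ?_, ?_⟩
      · intro b hb
        obtain ⟨v, hv, hcv, hp⟩ := hnz b hb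
        exact Finset.mem_image.2 ⟨v, Finset.mem_filter.2 ⟨hv, hp⟩, hcv⟩
      · exact Finset.card_image_le.trans hk.1
      · intro hx1
        refine Finset.card_image_le.trans (hk.2 ?_)
        by_contra hne
        push Not at hne
        have : ‖x‖ < 1 := by
          rw [pi_norm_lt_iff one_pos]
          intro i
          have hi := norm_le_pi_norm x i
          rw [hx1] at hi
          refine lt_of_le_of_ne hi fun he => ?_
          rw [Real.norm_eq_abs] at he
          rcases eq_or_eq_neg_of_abs_eq he with h | h
          · exact hne i M (by rw [h]; simp)
          · exact hne i (-M) (by rw [h]; simp)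
        linarith

end QF

namespace QF

/-- Faces of the clique complex of `R` on the vertex set `S`. -/
def CK {α : Type*} (R : α → α → Prop) (S : Set α) (τ : Finset α) : Prop :=
  τ.Nonempty ∧ (∀ x ∈ τ, x ∈ S) ∧ (τ : Set α).Pairwise R

lemma mem_rz {α : Type*} [Fintype α] {R : α → α → Prop} {S : Set α} {z : α → ℝ} :
    z ∈ rz (CK R S) ↔ (∀ a, 0 ≤ z a) ∧ ∑ a, z a = 1 ∧ (∀ a, z a ≠ 0 → a ∈ S) ∧
      ∀ a b, z a ≠ 0 → z b ≠ 0 → a ≠ b → R a b := by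
  classical
  constructor
  · rintro ⟨h1, h2, σ, ⟨h3, h4, h5⟩, h6⟩
    exact ⟨h1, h2, fun a ha => h4 a (h6 a ha), fun a b ha hb hab => h5 (h6 a ha) (h6 b hb) hab⟩
  · rintro ⟨h1, h2, h3, h4⟩
    refine ⟨h1, h2, Finset.univ.filter (fun a => z a ≠ 0), ⟨?_, ?_, ?_⟩, ?_⟩
    · by_contra h
      rw [Finset.not_nonempty_iff_eq_empty, Finset.filter_eq_empty_iff] at h
      have : ∑ a, z a = 0 := Finset.sum_eq_zero fun a ha => by simpa using h ha
      linarith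
    · simpa using h3
    · intro a ha b hb hab
      exact h4 a b (by simpa using ha) (by simpa using hb) hab
    · intro a ha
      simpa using ha

lemma rz_mono_set {α : Type*} [Fintype α] {R : α → α → Prop} {S T : Set α} (h : S ⊆ T) :
    rz (CK R S) ⊆ rz (CK R T) := by
  intro z hz
  rw [mem_rz] at hz ⊢
  exact ⟨hz.1, hz.2.1, fun a ha => h (hz.2.2.1 a ha), hz.2.2.2⟩

lemma CK_down {α : Type*} {R : α → α → Prop} {S : Set α} :
    ∀ σ τ : Finset α, CK R S σ → τ ⊆ σ → τ.Nonempty → CK R S τ := by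
  rintro σ τ ⟨-, h2, h3⟩ h hn
  exact ⟨hn, fun x hx => h2 x (h hx), h3.mono (by exact_mod_cast h)⟩

/-- linear interpolation inside a realization -/
lemma lin_mem {α : Type*} [Fintype α] {z w : α → ℝ} (hz0 : ∀ a, 0 ≤ z a) (hz1 : ∑ a, z a = 1)
    (hw0 : ∀ a, 0 ≤ w a) (hw1 : ∑ a, w a = 1) {t : ℝ} (ht : t ∈ Icc (0:ℝ) 1) :
    (∀ a, 0 ≤ ((1 - t) • z + t • w) a) ∧ ∑ a, ((1 - t) • z + t • w) a = 1 ∧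
    ∀ a, ((1 - t) • z + t • w) a ≠ 0 → z a ≠ 0 ∨ w a ≠ 0 := by
  refine ⟨fun a => ?_, ?_, fun a ha => ?_⟩
  · have := hz0 a
    have := hw0 a
    have := ht.1
    have : 0 ≤ 1 - t := by linarith [ht.2]
    simp only [Pi.add_apply, Pi.smul_apply, smul_eq_mul]
    positivity
  · simp only [Pi.add_apply, Pi.smul_apply, smul_eq_mul, Finset.sum_add_distrib, ← Finset.mul_sum,
      hz1, hw1]
    ring
  · by_contra h
    push Not at h
    apply ha
    simp [h.1, h.2]

/-- homotopy to a map with smaller supports -/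
lemma fills_lin {α : Type*} [Fintype α] {m : ℕ} {R : α → α → Prop} {S : Set α}
    {g g' : (Fin m → ℝ) → α → ℝ} (hg : ContinuousOn g (sphere 0 1))
    (hg' : ContinuousOn g' (sphere 0 1))
    (hM : ∀ x ∈ sphere (0 : Fin m → ℝ) 1, ∀ t ∈ Icc (0:ℝ) 1,
      (1 - t) • g x + t • g' x ∈ rz (CK R S)) (h : Fills (rz (CK R S)) g') :
    Fills (rz (CK R S)) g := by
  refine fills_of_homotopy (fun p => (1 - p.1) • g p.2 + p.1 • g' p.2) ?_ ?_ ?_ ?_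
  · have h1 : ContinuousOn (fun p : ℝ × (Fin m → ℝ) => g p.2) (Icc 0 1 ×ˢ sphere 0 1) :=
      hg.comp continuousOn_snd fun p hp => hp.2
    have h2 : ContinuousOn (fun p : ℝ × (Fin m → ℝ) => g' p.2) (Icc 0 1 ×ˢ sphere 0 1) :=
      hg'.comp continuousOn_snd fun p hp => hp.2
    exact ((continuousOn_const.sub continuousOn_fst).smul h1).add (continuousOn_fst.smul h2)
  · intro p hp
    exact hM p.2 hp.2 p.1 hp.1
  · intro x _
    simp
  · simpa using h

lemma lemR {α : Type*} [Fintype α] {R : α → α → Prop} {S : Set α}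
    {c : α} (hc : c ∉ S) {n : ℤ} (h1 : SetConn n (rz (CK R {x | x ∈ S ∧ R x c})))
    (h2 : SetConn n (rz (CK R (insert c S)))) : SetConn n (rz (CK R S)) := by
  classical
  intro m hm g hg hgM
  obtain ⟨G, hG, hGM, hGe⟩ := h2 m hm g hg (hgM.mono_right (rz_mono_set (subset_insert c S)))
  obtain ⟨G', hG', hA⟩ := approx (isCompact_closedBall (0 : Fin m → ℝ) 1) subset_rfl G hG
    (fun x hx => ⟨(hGM hx).1, (hGM hx).2.1⟩)
  set L : Set α := {x | x ∈ S ∧ R x c} with hL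
  have hLS : L ⊆ S := fun x hx => hx.1
  set s : Finset (Finset α) := Finset.univ.filter fun τ =>
    c ∈ τ ∧ (∀ x ∈ τ, x ∈ insert c L) ∧ (τ : Set α).Pairwise R ∧ (τ.card : ℤ) ≤ n + 2 with hs
  have hms : ∀ τ, τ ∈ s ↔ c ∈ τ ∧ (∀ x ∈ τ, x ∈ insert c L) ∧ (τ : Set α).Pairwise R ∧
      (τ.card : ℤ) ≤ n + 2 := fun τ => by simp [hs]
  obtain ⟨ρ, hρ, hρM, hρe⟩ := extend h1 CK_down id continuousOn_id (mapsTo_id _) s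
    (by
      intro σ hσ
      rw [hms] at hσ
      exact ⟨⟨c, hσ.1⟩, hσ.2.2.2, fun h => hc (hLS (h.2.1 c hσ.1))⟩)
    (by
      intro σ hσ τ hτ hn
      rw [hms] at hσ
      by_cases hcτ : c ∈ τ
      · right
        rw [hms]
        refine ⟨hcτ, fun x hx => hσ.2.1 x (hτ.1 hx), hσ.2.2.1.mono (by exact_mod_cast hτ.1), ?_⟩
        have := Finset.card_le_card hτ.1
        omega
      · left
        refine ⟨hn, fun x hx => ?_, hσ.2.2.1.mono (by exact_mod_cast hτ.1)⟩
        rcases hσ.2.1 x (hτ.1 hx) with h | h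
        · exact absurd (h ▸ hx) hcτ
        · exact h)
  obtain ⟨k, hk, hk1, hk2⟩ := glue (isClosed_rz (CK R S)) (isClosed_rz (fun τ => CK R L τ ∨ τ ∈ s))
    continuousOn_id hρ (by
      intro z hz hz'
      rw [hρe]
      rw [mem_rz] at hz ⊢
      refine ⟨hz.1, hz.2.1, fun a ha => ?_, hz.2.2.2⟩
      obtain ⟨-, -, σ, h | h, h4⟩ := hz'
      · exact h.2.1 a (h4 a ha)
      · rw [hms] at h
        rcases h.2.1 a (h4 a ha) with h | h
        · exact absurd (h ▸ hz.2.2.1 a ha) hc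
        · exact h)
  have hin : ∀ x ∈ closedBall (0 : Fin m → ℝ) 1,
      G' x ∈ rz (CK R S) ∪ rz (fun τ => CK R L τ ∨ τ ∈ s) := by
    intro x hx
    obtain ⟨a1, a2, a3, τ, a4, a5, -⟩ := hA x hx
    have hGx := mem_rz.1 (hGM hx)
    by_cases hcx : G' x c = 0
    · left
      rw [mem_rz]
      refine ⟨a1, a2, fun a ha => ?_, fun a b ha hb => hGx.2.2.2 a b (a3 a ha) (a3 b hb)⟩
      rcases hGx.2.2.1 a (a3 a ha) with h | h
      · exact absurd (h ▸ hcx) ha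
      · exact h
    · right
      refine ⟨a1, a2, Finset.univ.filter (fun a => G' x a ≠ 0), Or.inr ?_, by simp⟩
      rw [hms]
      refine ⟨by simpa using hcx, fun a ha => ?_, fun a ha b hb hab => ?_, ?_⟩
      · have ha : G' x a ≠ 0 := by simpa using ha
        by_cases hac : a = c
        · exact Or.inl hac
        · right
          refine ⟨?_, hGx.2.2.2 a c (a3 a ha) (a3 c hcx) hac⟩
          exact (hGx.2.2.1 a (a3 a ha)).resolve_left hac
      · exact hGx.2.2.2 a b (a3 a (by simpa using ha)) (a3 b (by simpa using hb)) hab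
      · have : (Finset.univ.filter (fun a => G' x a ≠ 0)).card ≤ τ.card :=
          Finset.card_le_card fun a ha => a4 a (by simpa using ha)
        omega
  have hsp : ∀ x ∈ sphere (0 : Fin m → ℝ) 1, ∀ t ∈ Icc (0:ℝ) 1,
      (1 - t) • g x + t • G' x ∈ rz (CK R S) := by
    intro x hx t ht
    obtain ⟨a1, a2, a3, -⟩ := hA x (sphere_subset_closedBall hx)
    have hgx := mem_rz.1 (hgM hx)
    obtain ⟨b1, b2, b3⟩ := lin_mem hgx.1 hgx.2.1 a1 a2 ht
    rw [hGe hx] at a3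
    have b4 : ∀ a, ((1 - t) • g x + t • G' x) a ≠ 0 → g x a ≠ 0 := fun a ha =>
      (b3 a ha).elim id (a3 a)
    exact mem_rz.2 ⟨b1, b2, fun a ha => hgx.2.2.1 a (b4 a ha), fun a b ha hb =>
      hgx.2.2.2 a b (b4 a ha) (b4 b hb)⟩
  refine fills_lin hg (hG'.mono sphere_subset_closedBall) hsp
    ⟨fun x => k (G' x), hk.comp hG' hin, fun x hx => ?_, fun x hx => ?_⟩
  · rcases hin x hx with h | h
    · show k (G' x) ∈ _
      rw [hk1 h]
      exact h
    · show k (G' x) ∈ _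
      rw [hk2 h]
      exact rz_mono_set hLS (hρM h)
  · have := hsp x hx 1 (by simp)
    simp only [sub_self, zero_smul, one_smul, zero_add] at this
    show k (G' x) = G' x
    rw [hk1 this]
    rfl

lemma lemC {α : Type*} [Fintype α] {R : α → α → Prop} (hR : ∀ a b, R a b → R b a) {S : Set α}
    {c e : α} (hc : c ∉ S) (he : e ∈ S) (hec : R e c)
    (hx : ∀ x ∈ S, R x c → x ≠ e → R x e) {n : ℤ}
    (h : SetConn n (rz (CK R S))) : SetConn n (rz (CK R (insert c S))) := by
  classical
  intro m hm g hg hgM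
  have hce : c ≠ e := fun h => hc (h ▸ he)
  set r : (α → ℝ) → α → ℝ := fun z => fun a => if a = c then 0 else if a = e then z e + z c else z a
    with hr
  have hrc : Continuous r := by
    refine continuous_pi fun a => ?_
    by_cases h1 : a = c
    · simp only [hr, h1, if_true]; fun_prop
    · by_cases h2 : a = e
      · simp only [hr, h1, h2, if_true, if_false, hce.symm]; fun_prop
      · simp only [hr, h1, h2, if_false]; fun_prop
  have hr0 : ∀ z : α → ℝ, (∀ a, 0 ≤ z a) → ∀ a, 0 ≤ r z a := by
    intro z hz a
    simp only [hr]
    split_ifs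
    · rfl
    · exact add_nonneg (hz _) (hz _)
    · exact hz _
  have hr1 : ∀ z : α → ℝ, ∑ a, r z a = ∑ a, z a := by
    intro z
    have : r z = fun a => z a + ((if a = e then z c else 0) - (if a = c then z c else 0)) := by
      ext a
      simp only [hr]
      split_ifs with h1 h2 h3
      · exact absurd (h1.symm.trans h2) hce
      · simp [h1]
      · simp [h3]
      · simp
    rw [this]
    simp [Finset.sum_add_distrib]
  have hrs : ∀ z : α → ℝ, ∀ a, r z a ≠ 0 → a ≠ c ∧ (z a ≠ 0 ∨ (a = e ∧ z c ≠ 0)) := by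
    intro z a ha
    simp only [hr] at ha
    split_ifs at ha with h1 h2
    · exact absurd rfl ha
    · refine ⟨h1, ?_⟩
      subst h2
      by_contra h'
      push Not at h'
      apply ha
      rw [h'.1, h'.2 rfl, add_zero]
    · exact ⟨h1, Or.inl ha⟩
  have key : ∀ z ∈ rz (CK R (insert c S)), ∀ a b, (z a ≠ 0 ∨ r z a ≠ 0) → (z b ≠ 0 ∨ r z b ≠ 0) →
      a ≠ b → R a b := by
    intro z hz a b ha hb hab
    rw [mem_rz] at hz
    have ha' : z a ≠ 0 ∨ (a = e ∧ z c ≠ 0) := ha.elim Or.inl fun h => (hrs z a h).2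
    have hb' : z b ≠ 0 ∨ (b = e ∧ z c ≠ 0) := hb.elim Or.inl fun h => (hrs z b h).2
    have k1 : ∀ a, a ≠ e → z a ≠ 0 → z c ≠ 0 → R a e := by
      intro a hae h1 h2
      by_cases hac : a = c
      · subst hac; exact hR _ _ hec
      · exact hx a ((hz.2.2.1 a h1).resolve_left hac) (hz.2.2.2 a c h1 h2 hac) hae
    rcases ha' with h1 | ⟨rfl, h1⟩ <;> rcases hb' with h2 | ⟨rfl, h2⟩
    · exact hz.2.2.2 a b h1 h2 hab
    · exact k1 a hab h1 h2
    · exact hR _ _ (k1 b hab.symm h2 h1)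
    · exact absurd rfl hab
  have hrM : ∀ z ∈ rz (CK R (insert c S)), r z ∈ rz (CK R S) := by
    intro z hz
    have hz' := mem_rz.1 hz
    refine mem_rz.2 ⟨hr0 z hz'.1, (hr1 z).trans hz'.2.1, fun a ha => ?_, fun a b ha hb hab =>
      key z hz a b (Or.inr ha) (Or.inr hb) hab⟩
    obtain ⟨h1, h2 | h2⟩ := hrs z a ha
    · exact (hz'.2.2.1 a h2).resolve_left h1
    · exact h2.1 ▸ he
  have hrg : ContinuousOn (fun x => r (g x)) (sphere 0 1) := hrc.comp_continuousOn hg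
  refine fills_lin hg hrg ?_ ((h m hm _ hrg fun x hx => hrM _ (hgM hx)).mono
    (rz_mono_set (subset_insert c S)))
  intro x hx t ht
  have hz := mem_rz.1 (hgM hx)
  have hw := mem_rz.1 (hrM _ (hgM hx))
  obtain ⟨b1, b2, b3⟩ := lin_mem hz.1 hz.2.1 hw.1 hw.2.1 ht
  exact mem_rz.2 ⟨b1, b2, fun a ha => (b3 a ha).elim (hz.2.2.1 a) fun h => Or.inr (hw.2.2.1 a h),
    fun a b ha hb hab => key _ (hgM hx) a b (b3 a ha) (b3 b hb) hab⟩

end QF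

namespace QF

/-- The cone over the realization of the clique complex. -/
def Cn {α : Type*} (R : α → α → Prop) (S : Set α) : Set (α → ℝ) :=
  {x | (∀ a, 0 ≤ x a) ∧ (∀ a, x a ≠ 0 → a ∈ S) ∧ ∀ a b, x a ≠ 0 → x b ≠ 0 → a ≠ b → R a b}

open Classical in
/-- The number of nonzero coordinates. -/
def nsupp {α : Type*} [Fintype α] (x : α → ℝ) : ℕ := (Finset.univ.filter fun a => x a ≠ 0).card

/-- domain of the cone extension -/
def DD {α : Type*} [Fintype α] (R : α → α → Prop) (S : Set α) (k : ℕ) : Set (ℝ × (α → ℝ)) :=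
  {p | 0 ≤ p.1 ∧ p.2 ∈ Cn R S ∧ (p.1 ≠ 0 → nsupp p.2 ≤ k)}

lemma coneExt {α : Type*} [Fintype α] {R : α → α → Prop} {A : Set α} {k : ℕ}
    (h : SetConn ((k : ℤ) - 1) (rz (CK R A))) :
    ∃ ρ : ℝ × (α → ℝ) → α → ℝ, ContinuousOn ρ (DD R A k) ∧
      (∀ p ∈ DD R A k, ρ p ∈ Cn R A ∧ ∑ a, ρ p a = p.1 + ∑ a, p.2 a) ∧
      (∀ x ∈ Cn R A, ρ (0, x) = x) := by
  classical
  set K : Finset (Option α) → Prop := fun σ => none ∉ σ ∧ CK R A (Finset.eraseNone σ) with hK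
  set s : Finset (Finset (Option α)) := Finset.univ.filter fun σ => none ∈ σ ∧
    (∀ x ∈ Finset.eraseNone σ, x ∈ A) ∧ ((Finset.eraseNone σ : Finset α) : Set α).Pairwise R ∧
    (Finset.eraseNone σ).card ≤ k with hs
  have hms : ∀ σ, σ ∈ s ↔ none ∈ σ ∧
    (∀ x ∈ Finset.eraseNone σ, x ∈ A) ∧ ((Finset.eraseNone σ : Finset α) : Set α).Pairwise R ∧
    (Finset.eraseNone σ).card ≤ k := fun σ => by simp [hs]
  have hsub : ∀ σ τ : Finset (Option α), τ ⊆ σ → Finset.eraseNone τ ⊆ Finset.eraseNone σ :=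
    fun σ τ hστ => Finset.eraseNone.monotone hστ
  have hsum : ∀ z : Option α → ℝ, ∑ a, z a = z none + ∑ a, z (some a) := fun z => by
    rw [Fintype.sum_option]
  obtain ⟨F, hF, hFM, hFe⟩ := extend (K := K) h (by
      rintro σ τ ⟨h1, h2⟩ h3 ⟨o, ho⟩
      have h4 : none ∉ τ := fun h => h1 (h3 h)
      refine ⟨h4, CK_down _ _ h2 (hsub _ _ h3) ?_⟩
      cases o with
      | none => exact absurd ho h4
      | some a => exact ⟨a, by simpa using ho⟩) (fun z a => z (some a)) (by fun_prop) (by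
      rintro z ⟨h1, h2, σ, ⟨h3, h4⟩, h5⟩
      refine ⟨fun a => h1 _, ?_, _, h4, fun a ha => by simpa using h5 _ ha⟩
      have : z none = 0 := by
        by_contra h
        exact h3 (h5 _ h)
      rw [← h2, hsum, this, zero_add]) s (by
      intro σ hσ
      rw [hms] at hσ
      refine ⟨⟨_, hσ.1⟩, ?_, fun h => h.1 hσ.1⟩
      have := Finset.card_eraseNone_of_mem hσ.1
      omega) (by
      intro σ hσ τ hτ hn
      rw [hms] at hσ
      by_cases h4 : none ∈ τ
      · right
        rw [hms]
        refine ⟨h4, fun x hx => hσ.2.1 x (hsub _ _ hτ.1 hx), hσ.2.2.1.mono ?_, ?_⟩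
        · exact_mod_cast hsub _ _ hτ.1
        · exact (Finset.card_le_card (hsub _ _ hτ.1)).trans hσ.2.2.2
      · left
        obtain ⟨o, ho⟩ := hn
        refine ⟨h4, ?_, fun x hx => hσ.2.1 x (hsub _ _ hτ.1 hx), hσ.2.2.1.mono ?_⟩
        · cases o with
          | none => exact absurd ho h4
          | some a => exact ⟨a, by simpa using ho⟩
        · exact_mod_cast hsub _ _ hτ.1)
  set T : ℝ × (α → ℝ) → ℝ := fun p => p.1 + ∑ a, p.2 a with hT
  set E : ℝ × (α → ℝ) → Option α → ℝ := fun p o => (T p)⁻¹ * o.elim p.1 p.2 with hE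
  have hTc : Continuous T := by fun_prop
  have hT0 : ∀ p ∈ DD R A k, 0 ≤ T p := fun p hp =>
    add_nonneg hp.1 (Finset.sum_nonneg fun a _ => hp.2.1.1 a)
  have hEm : ∀ p ∈ DD R A k, T p ≠ 0 → E p ∈ rz (fun τ => K τ ∨ τ ∈ s) := by
    intro p hp hTp
    have hTp' : 0 < T p := lt_of_le_of_ne (hT0 p hp) (Ne.symm hTp)
    refine ⟨fun o => ?_, ?_, Finset.univ.filter (fun o => E p o ≠ 0), ?_, by simp⟩
    · refine mul_nonneg (inv_nonneg.2 hTp'.le) ?_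
      cases o with
      | none => exact hp.1
      | some a => exact hp.2.1.1 a
    · rw [hsum]
      simp only [hE, Option.elim, ← Finset.mul_sum, ← mul_add]
      exact inv_mul_cancel₀ hTp
    · have e1 : ∀ a, a ∈ Finset.eraseNone (Finset.univ.filter (fun o => E p o ≠ 0)) ↔ p.2 a ≠ 0 := by
        intro a
        simp [hE, hTp]
      have e2 : Finset.eraseNone (Finset.univ.filter (fun o => E p o ≠ 0)) =
          Finset.univ.filter (fun a => p.2 a ≠ 0) := by
        ext a; rw [e1]; simp
      have e3 : none ∈ (Finset.univ.filter (fun o => E p o ≠ 0)) ↔ p.1 ≠ 0 := by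
        simp [hE, hTp]
      have c1 : ∀ x ∈ Finset.eraseNone (Finset.univ.filter (fun o => E p o ≠ 0)), x ∈ A := by
        intro a ha
        exact hp.2.1.2.1 a ((e1 a).1 ha)
      have c2 : ((Finset.eraseNone (Finset.univ.filter (fun o => E p o ≠ 0)) : Finset α) :
          Set α).Pairwise R := by
        intro a ha b hb hab
        exact hp.2.1.2.2 a b ((e1 a).1 ha) ((e1 b).1 hb) hab
      by_cases hp1 : p.1 = 0
      · left
        refine ⟨fun h => e3.1 h hp1, ?_, c1, c2⟩
        rw [e2]
        by_contra h
        rw [Finset.not_nonempty_iff_eq_empty, Finset.filter_eq_empty_iff] at h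
        have : ∑ a, p.2 a = 0 := Finset.sum_eq_zero fun a ha => by simpa using h ha
        apply hTp
        simp [hT, this, hp1]
      · right
        rw [hms]
        refine ⟨e3.2 hp1, c1, c2, ?_⟩
        rw [e2]
        exact hp.2.2 hp1
  set ρ : ℝ × (α → ℝ) → α → ℝ := fun p => T p • F (E p) with hρ
  have hρ1 : ∀ p ∈ DD R A k, ρ p ∈ Cn R A ∧ ∑ a, ρ p a = p.1 + ∑ a, p.2 a := by
    intro p hp
    by_cases hTp : T p = 0
    · have : ρ p = 0 := by simp [hρ, hTp]
      rw [this]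
      refine ⟨⟨by simp, by simp, by simp⟩, ?_⟩
      simpa using hTp.symm
    · have := mem_rz.1 (hFM (hEm p hp hTp))
      have hn : ∀ a, ρ p a ≠ 0 → F (E p) a ≠ 0 := fun a ha => by
        simp only [hρ, Pi.smul_apply, smul_eq_mul] at ha
        exact right_ne_zero_of_mul ha
      refine ⟨⟨fun a => mul_nonneg (hT0 p hp) (this.1 a), fun a ha => this.2.2.1 a (hn a ha),
        fun a b ha hb => this.2.2.2 a b (hn a ha) (hn b hb)⟩, ?_⟩
      simp only [hρ, Pi.smul_apply, smul_eq_mul, ← Finset.mul_sum, this.2.1, mul_one, hT]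
  refine ⟨ρ, ?_, hρ1, ?_⟩
  · intro p hp
    by_cases hTp : T p = 0
    · have h0 : ρ p = 0 := by simp [hρ, hTp]
      rw [ContinuousWithinAt, h0]
      apply squeeze_zero_norm' (a := T)
      · filter_upwards [self_mem_nhdsWithin] with p' hp'
        rw [pi_norm_le_iff_of_nonneg (hT0 p' hp')]
        intro a
        obtain ⟨h1, h2⟩ := hρ1 p' hp'
        rw [Real.norm_eq_abs, abs_of_nonneg (h1.1 a)]
        show _ ≤ p'.1 + ∑ a, p'.2 a
        rw [← h2]
        exact Finset.single_le_sum (f := ρ p') (fun i _ => h1.1 i) (Finset.mem_univ a)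
      · have := hTc.continuousWithinAt (s := DD R A k) (x := p)
        rw [ContinuousWithinAt, hTp] at this
        exact this
    · have hEc : ContinuousOn E {p | T p ≠ 0} := by
        refine continuousOn_pi.2 fun o => ?_
        refine (hTc.continuousOn.inv₀ fun p hp => hp).mul ?_
        cases o with
        | none => exact continuousOn_fst
        | some a => exact ((continuous_apply a).comp continuous_snd).continuousOn
      have hop : IsOpen {p | T p ≠ 0} := isOpen_ne_fun hTc continuous_const
      have : ContinuousOn ρ (DD R A k ∩ {p | T p ≠ 0}) := by
        refine hTc.continuousOn.smul (hF.comp (hEc.mono inter_subset_right) ?_)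
        intro p hp
        exact hEm p hp.1 hp.2
      exact (this p ⟨hp, hTp⟩).mono_of_mem_nhdsWithin
        (inter_mem_nhdsWithin _ (hop.mem_nhds hTp))
  · intro x hx
    have hp : ((0:ℝ), x) ∈ DD R A k := ⟨le_rfl, hx, fun h => absurd rfl h⟩
    by_cases hTp : T (0, x) = 0
    · have h0 : ρ (0, x) = 0 := by simp [hρ, hTp]
      rw [h0]
      have h1 : ∑ a, x a = 0 := by simpa [hT] using hTp
      rw [Finset.sum_eq_zero_iff_of_nonneg fun a _ => hx.1 a] at h1
      ext a
      exact (h1 a (Finset.mem_univ a)).symm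
    · have h1 : E (0, x) ∈ rz K := by
        obtain ⟨h1, h2, -⟩ := hEm _ hp hTp
        refine ⟨h1, h2, Finset.univ.filter (fun o => E (0, x) o ≠ 0), ⟨by simp [hE], ?_, ?_, ?_⟩,
          by simp⟩
        · by_contra h
          rw [Finset.not_nonempty_iff_eq_empty] at h
          have : ∀ a, x a = 0 := by
            intro a
            by_contra hxa
            have : a ∈ Finset.eraseNone (Finset.univ.filter (fun o => E (0, x) o ≠ 0)) := by
              simp [hE, hTp, hxa]
            rw [h] at this
            simp at this
          apply hTp
          simp [hT, this]
        · intro a ha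
          apply hx.2.1
          simp [hE, hTp] at ha
          exact ha
        · intro a ha b hb
          simp [hE, hTp] at ha hb
          exact hx.2.2 a b ha hb
      show T (0, x) • F (E (0, x)) = x
      rw [hFe h1]
      ext a
      simp only [hE, Pi.smul_apply, smul_eq_mul, Option.elim]
      rw [mul_inv_cancel_left₀ hTp]

end QF

namespace QF

open Classical in
/-- the `(k+1)`-st largest coordinate (in absolute value) -/
def us {α : Type*} [Fintype α] (k : ℕ) (x : α → ℝ) : ℝ :=
  (Finset.univ.filter fun T : Finset α => T.card ≤ k).inf' ⟨∅, by simp⟩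
    fun T => ‖fun i => if i ∈ T then 0 else x i‖

lemma us_cont {α : Type*} [Fintype α] (k : ℕ) : Continuous (us (α := α) k) := by
  classical
  refine Continuous.finset_inf'_apply _ fun T _ => ?_
  refine continuous_norm.comp (continuous_pi fun i => ?_)
  by_cases h : i ∈ T
  · simp only [h, if_true]; fun_prop
  · simp only [h, if_false]; fun_prop

lemma us_nonneg {α : Type*} [Fintype α] (k : ℕ) (x : α → ℝ) : 0 ≤ us k x := by
  refine Finset.le_inf' _ _ fun T _ => norm_nonneg _

lemma us_zero {α : Type*} [Fintype α] {k : ℕ} {x : α → ℝ} (h : nsupp x ≤ k) : us k x = 0 := by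
  classical
  refine le_antisymm ?_ (us_nonneg k x)
  refine (Finset.inf'_le _ (b := Finset.univ.filter fun a => x a ≠ 0) (Finset.mem_filter.2 ⟨Finset.mem_univ _, h⟩)).trans ?_
  rw [pi_norm_le_iff_of_nonneg le_rfl]
  intro i
  by_cases hi : x i = 0 <;> simp [hi]

lemma nsupp_le {α : Type*} [Fintype α] {x : α → ℝ} {T : Finset α} (h : ∀ a, x a ≠ 0 → a ∈ T) :
    nsupp x ≤ T.card := by
  classical
  refine Finset.card_le_card fun a ha => h a ?_
  simpa using ha

lemma nsupp_mono {α : Type*} [Fintype α] {x y : α → ℝ} (h : ∀ a, x a ≠ 0 → y a ≠ 0) :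
    nsupp x ≤ nsupp y := by
  classical
  refine nsupp_le fun a ha => ?_
  simpa using h a ha

lemma us_trunc {α : Type*} [Fintype α] (k : ℕ) (x : α → ℝ) :
    nsupp (fun i => max (x i - us k x) 0) ≤ k := by
  classical
  obtain ⟨T, hT, he⟩ := Finset.exists_mem_eq_inf' (s := Finset.univ.filter fun T : Finset α =>
    T.card ≤ k) ⟨∅, by simp⟩ (fun T => ‖fun i => if i ∈ T then 0 else x i‖)
  change us k x = _ at he
  refine (nsupp_le (T := T) fun a ha => ?_).trans (by simpa using hT)
  by_contra h
  apply ha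
  rw [max_eq_right]
  have := norm_le_pi_norm (fun i => if i ∈ T then 0 else x i) a
  simp only [h, if_false] at this
  rw [he, sub_nonpos]
  exact (le_abs_self _).trans this

lemma fills_supp {α : Type*} [Fintype α] {m : ℕ} {R : α → α → Prop} {S : Set α}
    {g g' : (Fin m → ℝ) → α → ℝ} (hg : ContinuousOn g (sphere 0 1))
    (hgM : MapsTo g (sphere 0 1) (rz (CK R S)))
    (hg' : ContinuousOn g' (sphere 0 1))
    (h1 : ∀ x ∈ sphere (0 : Fin m → ℝ) 1, ∀ a, 0 ≤ g' x a)
    (h2 : ∀ x ∈ sphere (0 : Fin m → ℝ) 1, ∑ a, g' x a = 1)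
    (h3 : ∀ x ∈ sphere (0 : Fin m → ℝ) 1, ∀ a, g' x a ≠ 0 → g x a ≠ 0)
    (h : Fills (rz (CK R S)) g') : Fills (rz (CK R S)) g := by
  refine fills_lin hg hg' ?_ h
  intro x hx t ht
  have hgx := mem_rz.1 (hgM hx)
  obtain ⟨b1, b2, b3⟩ := lin_mem hgx.1 hgx.2.1 (h1 x hx) (h2 x hx) ht
  have b4 : ∀ a, ((1 - t) • g x + t • g' x) a ≠ 0 → g x a ≠ 0 := fun a ha =>
    (b3 a ha).elim id (h3 x hx a)
  exact mem_rz.2 ⟨b1, b2, fun a ha => hgx.2.2.1 a (b4 a ha), fun a b ha hb =>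
    hgx.2.2.2 a b (b4 a ha) (b4 b hb)⟩

lemma Cn_supp {α : Type*} {R : α → α → Prop} {S : Set α} {x y : α → ℝ} (hx : x ∈ Cn R S)
    (h0 : ∀ a, 0 ≤ y a) (h : ∀ a, y a ≠ 0 → x a ≠ 0) : y ∈ Cn R S :=
  ⟨h0, fun a ha => hx.2.1 a (h a ha), fun a b ha hb => hx.2.2 a b (h a ha) (h b hb)⟩

lemma trunc_supp {α : Type*} {x : α → ℝ} (hx : ∀ a, 0 ≤ x a) {c : ℝ} (hc : 0 ≤ c) :
    ∀ a, max (x a - c) 0 ≠ 0 → x a ≠ 0 := by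
  intro a ha h
  apply ha
  rw [h, max_eq_right]
  linarith

lemma join_nat {α : Type*} [Fintype α] {R : α → α → Prop} (hR : ∀ a b, R a b → R b a)
    {A B : Set α} (hAB : ∀ a ∈ A, ∀ b ∈ B, R a b) (hd : Disjoint A B) {k l : ℕ}
    (hA : SetConn ((k : ℤ) - 1) (rz (CK R A))) (hB : SetConn ((l : ℤ) - 1) (rz (CK R B))) :
    SetConn ((k : ℤ) + l) (rz (CK R (A ∪ B))) := by
  classical
  obtain ⟨ρ, hρc, hρ, hρ0⟩ := coneExt hA
  obtain ⟨η, hηc, hη, hη0⟩ := coneExt hB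
  intro m hm g hg hgM
  obtain ⟨g', hg', hA'⟩ := approx (isCompact_sphere (0 : Fin m → ℝ) 1) sphere_subset_closedBall g hg
    (fun x hx => ⟨(hgM hx).1, (hgM hx).2.1⟩)
  refine fills_supp hg hgM hg' (fun x hx => (hA' x hx).1) (fun x hx => (hA' x hx).2.1)
    (fun x hx => (hA' x hx).2.2.1) ?_
  have hg'M : ∀ p ∈ sphere (0 : Fin m → ℝ) 1, g' p ∈ rz (CK R (A ∪ B)) := by
    intro p hp
    obtain ⟨a1, a2, a3, -⟩ := hA' p hp
    have := mem_rz.1 (hgM hp)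
    exact mem_rz.2 ⟨a1, a2, fun a ha => this.2.2.1 a (a3 a ha), fun a b ha hb =>
      this.2.2.2 a b (a3 a ha) (a3 b hb)⟩
  set x : (Fin m → ℝ) → α → ℝ := fun p => A.indicator (g' p) with hx
  set y : (Fin m → ℝ) → α → ℝ := fun p => B.indicator (g' p) with hy
  have indc : ∀ (A : Set α), ContinuousOn (fun p => A.indicator (g' p)) (sphere 0 1) := by
    intro A
    refine continuousOn_pi.2 fun a => ?_
    by_cases ha : a ∈ A
    · simp only [indicator_of_mem ha]
      exact (continuous_apply a).comp_continuousOn hg'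
    · simp only [indicator_of_notMem ha]
      exact continuousOn_const
  have hxc : ContinuousOn x (sphere 0 1) := indc A
  have hyc : ContinuousOn y (sphere 0 1) := indc B
  have indm : ∀ (A' : Set α), ∀ p ∈ sphere (0 : Fin m → ℝ) 1, A'.indicator (g' p) ∈ Cn R A' := by
    intro A' p hp
    have := mem_rz.1 (hg'M p hp)
    have hn : ∀ a, A'.indicator (g' p) a ≠ 0 → a ∈ A' ∧ g' p a ≠ 0 := by
      intro a ha
      by_cases h : a ∈ A'
      · rw [indicator_of_mem h] at ha
        exact ⟨h, ha⟩
      · rw [indicator_of_notMem h] at ha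
        exact absurd rfl ha
    exact ⟨fun a => indicator_nonneg (fun a _ => this.1 a) a, fun a ha => (hn a ha).1,
      fun a b ha hb => this.2.2.2 a b (hn a ha).2 (hn b hb).2⟩
  have hxm : ∀ p ∈ sphere (0 : Fin m → ℝ) 1, x p ∈ Cn R A := indm A
  have hym : ∀ p ∈ sphere (0 : Fin m → ℝ) 1, y p ∈ Cn R B := indm B
  have hxy : ∀ p ∈ sphere (0 : Fin m → ℝ) 1, x p + y p = g' p := by
    intro p hp
    have := mem_rz.1 (hg'M p hp)
    ext a
    simp only [hx, hy, Pi.add_apply]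
    by_cases h1 : a ∈ A
    · have h2 : a ∉ B := fun h => disjoint_left.1 hd h1 h
      simp [h1, h2]
    · by_cases h2 : a ∈ B
      · simp [h1, h2]
      · have : g' p a = 0 := by
          by_contra h
          rcases this.2.2.1 a h with h | h
          · exact h1 h
          · exact h2 h
        simp [h1, h2, this]
  have hcard : ∀ p ∈ sphere (0 : Fin m → ℝ) 1, nsupp (x p) + nsupp (y p) ≤ k + l + 1 := by
    intro p hp
    obtain ⟨-, -, -, τ, h1, -, h2⟩ := hA' p hp
    have h2 := h2 (by simpa using hp)
    have : nsupp (x p) + nsupp (y p) ≤ τ.card := by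
      unfold nsupp
      rw [← Finset.card_union_of_disjoint]
      · refine Finset.card_le_card fun a ha => h1 a ?_
        simp only [Finset.mem_union, Finset.mem_filter, Finset.mem_univ, true_and] at ha
        intro h0
        rcases ha with ha | ha <;> apply ha
        · by_cases h : a ∈ A <;> simp [hx, h, h0]
        · by_cases h : a ∈ B <;> simp [hy, h, h0]
      · rw [Finset.disjoint_left]
        intro a ha hb
        exact disjoint_left.1 hd ((hxm p hp).2.1 a (by simpa using ha))
          ((hym p hp).2.1 a (by simpa using hb))
    omega
  set u : (Fin m → ℝ) → ℝ := fun p => us k (x p) with hu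
  set v : (Fin m → ℝ) → ℝ := fun p => us l (y p) with hv
  have huc : ContinuousOn u (sphere 0 1) := (us_cont k).comp_continuousOn hxc
  have hvc : ContinuousOn v (sphere 0 1) := (us_cont l).comp_continuousOn hyc
  have hu0 : ∀ p, 0 ≤ u p := fun p => us_nonneg _ _
  have hv0 : ∀ p, 0 ≤ v p := fun p => us_nonneg _ _
  have hux : ∀ p ∈ sphere (0 : Fin m → ℝ) 1, v p ≠ 0 → nsupp (x p) ≤ k := by
    intro p hp h
    have : ¬ nsupp (y p) ≤ l := fun h' => h (us_zero h')
    have := hcard p hp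
    omega
  have hvy : ∀ p ∈ sphere (0 : Fin m → ℝ) 1, u p ≠ 0 → nsupp (y p) ≤ l := by
    intro p hp h
    have : ¬ nsupp (x p) ≤ k := fun h' => h (us_zero h')
    have := hcard p hp
    omega
  set N : (α → ℝ) → α → ℝ := fun w => (∑ a, w a)⁻¹ • w with hN
  have ptw : ∀ w w', w ∈ DD R A k → w' ∈ DD R B l →
      0 < (w.1 + ∑ a, w.2 a) + (w'.1 + ∑ a, w'.2 a) → N (ρ w + η w') ∈ rz (CK R (A ∪ B)) := by
    intro w w' hw hw' hpos
    have hsum : 0 < ∑ a, (ρ w + η w') a := by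
      simp only [Pi.add_apply, Finset.sum_add_distrib]
      rw [(hρ _ hw).2, (hη _ hw').2]
      exact hpos
    have h1 := (hρ _ hw).1
    have h2 := (hη _ hw').1
    have hne : ∀ a, N (ρ w + η w') a ≠ 0 → ρ w a ≠ 0 ∨ η w' a ≠ 0 := by
      intro a ha
      by_contra h
      push Not at h
      apply ha
      simp [hN, h.1, h.2]
    refine mem_rz.2 ⟨fun a => ?_, ?_, fun a ha => ?_, fun a b ha hb hab => ?_⟩
    · exact mul_nonneg (inv_nonneg.2 (hsum).le) (add_nonneg (h1.1 a) (h2.1 a))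
    · simp only [hN, Pi.smul_apply, smul_eq_mul, ← Finset.mul_sum]
      exact inv_mul_cancel₀ (hsum).ne'
    · exact (hne a ha).imp (h1.2.1 a) (h2.2.1 a)
    · rcases hne a ha with ha | ha <;> rcases hne b hb with hb | hb
      · exact h1.2.2 a b ha hb hab
      · exact hAB a (h1.2.1 a ha) b (h2.2.1 b hb)
      · exact hR _ _ (hAB b (h1.2.1 b hb) a (h2.2.1 a ha))
      · exact h2.2.2 a b ha hb hab
  have hom : ∀ pA pB : ℝ × (Fin m → ℝ) → ℝ × (α → ℝ),
      ContinuousOn pA (Icc 0 1 ×ˢ sphere 0 1) → ContinuousOn pB (Icc 0 1 ×ˢ sphere 0 1) →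
      MapsTo pA (Icc 0 1 ×ˢ sphere 0 1) (DD R A k) → MapsTo pB (Icc 0 1 ×ˢ sphere 0 1) (DD R B l) →
      (∀ q ∈ Icc (0:ℝ) 1 ×ˢ sphere (0 : Fin m → ℝ) 1,
        0 < ((pA q).1 + ∑ a, (pA q).2 a) + ((pB q).1 + ∑ a, (pB q).2 a)) →
      ContinuousOn (fun q => N (ρ (pA q) + η (pB q))) (Icc 0 1 ×ˢ sphere 0 1) ∧
      MapsTo (fun q => N (ρ (pA q) + η (pB q))) (Icc 0 1 ×ˢ sphere 0 1) (rz (CK R (A ∪ B))) := by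
    intro pA pB hpA hpB hA1 hB1 hpos
    have hsum : ∀ q ∈ Icc (0:ℝ) 1 ×ˢ sphere (0 : Fin m → ℝ) 1,
        0 < ∑ a, (ρ (pA q) + η (pB q)) a := by
      intro q hq
      simp only [Pi.add_apply, Finset.sum_add_distrib]
      rw [(hρ _ (hA1 hq)).2, (hη _ (hB1 hq)).2]
      exact hpos q hq
    have hc : ContinuousOn (fun q => ρ (pA q) + η (pB q)) (Icc 0 1 ×ˢ sphere 0 1) :=
      (hρc.comp hpA hA1).add (hηc.comp hpB hB1)
    constructor
    · refine ContinuousOn.smul (ContinuousOn.inv₀ ?_ fun q hq => (hsum q hq).ne') hc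
      exact continuousOn_finsetSum _ fun a _ => (continuous_apply a).comp_continuousOn hc
    · intro q hq
      exact ptw _ _ (hA1 hq) (hB1 hq) (hpos q hq)
  have cu : ContinuousOn (fun q : ℝ × (Fin m → ℝ) => u q.2) (Icc 0 1 ×ˢ sphere 0 1) :=
    huc.comp continuousOn_snd fun q hq => hq.2
  have cv : ContinuousOn (fun q : ℝ × (Fin m → ℝ) => v q.2) (Icc 0 1 ×ˢ sphere 0 1) :=
    hvc.comp continuousOn_snd fun q hq => hq.2
  have cx : ∀ i, ContinuousOn (fun q : ℝ × (Fin m → ℝ) => x q.2 i) (Icc 0 1 ×ˢ sphere 0 1) :=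
    fun i => (continuous_apply i).comp_continuousOn
      (hxc.comp continuousOn_snd fun q hq => hq.2)
  have cy : ∀ i, ContinuousOn (fun q : ℝ × (Fin m → ℝ) => y q.2 i) (Icc 0 1 ×ˢ sphere 0 1) :=
    fun i => (continuous_apply i).comp_continuousOn
      (hyc.comp continuousOn_snd fun q hq => hq.2)
  have c1 : ContinuousOn (fun q : ℝ × (Fin m → ℝ) => q.1) (Icc 0 1 ×ˢ sphere 0 1) :=
    continuousOn_fst
  have maxc : ∀ {f : ℝ × (Fin m → ℝ) → ℝ}, ContinuousOn f (Icc 0 1 ×ˢ sphere 0 1) →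
      ContinuousOn (fun q => max (f q) 0) (Icc 0 1 ×ˢ sphere 0 1) := fun hf =>
    (continuous_id.max continuous_const).comp_continuousOn hf
  -- first stage
  obtain ⟨H1c, H1M⟩ := hom
    (fun q => (q.1 * v q.2, fun i => max (x q.2 i - q.1 * u q.2) 0))
    (fun q => (q.1 * u q.2, fun i => max (y q.2 i - q.1 * v q.2) 0))
    ((c1.mul cv).prodMk (continuousOn_pi.2 fun i => maxc ((cx i).sub (c1.mul cu))))
    ((c1.mul cu).prodMk (continuousOn_pi.2 fun i => maxc ((cy i).sub (c1.mul cv))))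
    (by
      rintro ⟨t, p⟩ ⟨ht, hp⟩
      have := trunc_supp (hxm p hp).1 (mul_nonneg ht.1 (hu0 p))
      refine ⟨mul_nonneg ht.1 (hv0 p), Cn_supp (hxm p hp) (fun a => le_max_right _ _) this, ?_⟩
      intro h
      exact (nsupp_mono this).trans (hux p hp (right_ne_zero_of_mul h)))
    (by
      rintro ⟨t, p⟩ ⟨ht, hp⟩
      have := trunc_supp (hym p hp).1 (mul_nonneg ht.1 (hv0 p))
      refine ⟨mul_nonneg ht.1 (hu0 p), Cn_supp (hym p hp) (fun a => le_max_right _ _) this, ?_⟩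
      intro h
      exact (nsupp_mono this).trans (hvy p hp (right_ne_zero_of_mul h)))
    (by
      rintro ⟨t, p⟩ ⟨ht, hp⟩
      simp only
      have e1 : 0 ≤ t * v p := mul_nonneg ht.1 (hv0 p)
      have e2 : 0 ≤ t * u p := mul_nonneg ht.1 (hu0 p)
      have e3 : 0 ≤ ∑ a, max (x p a - t * u p) 0 := Finset.sum_nonneg fun a _ => le_max_right _ _
      have e4 : 0 ≤ ∑ a, max (y p a - t * v p) 0 := Finset.sum_nonneg fun a _ => le_max_right _ _
      rcases e1.eq_or_lt with h1 | h1
      · rcases e2.eq_or_lt with h2 | h2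
        · rw [← h1, ← h2]
          have := (hA' p hp).2.1
          rw [← hxy p hp] at this
          simp only [Pi.add_apply, Finset.sum_add_distrib] at this
          simp only [sub_zero, max_eq_left ((hxm p hp).1 _), max_eq_left ((hym p hp).1 _)]
          linarith
        · linarith
      · linarith)
  refine fills_of_homotopy _ H1c H1M ?_ ?_
  · intro p hp
    simp only [zero_mul, sub_zero, max_eq_left ((hxm p hp).1 _), max_eq_left ((hym p hp).1 _)]
    rw [hρ0 _ (hxm p hp), hη0 _ (hym p hp), hxy p hp, hN]
    simp [(hA' p hp).2.1]
  -- second stage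
  obtain ⟨H2c, H2M⟩ := hom
    (fun q => ((1 - q.1) * v q.2 + q.1, fun i => (1 - q.1) * max (x q.2 i - u q.2) 0))
    (fun q => ((1 - q.1) * u q.2, fun i => (1 - q.1) * max (y q.2 i - v q.2) 0))
    ((((continuousOn_const.sub c1).mul cv).add c1).prodMk (continuousOn_pi.2 fun i =>
      (continuousOn_const.sub c1).mul (maxc ((cx i).sub cu))))
    (((continuousOn_const.sub c1).mul cu).prodMk (continuousOn_pi.2 fun i =>
      (continuousOn_const.sub c1).mul (maxc ((cy i).sub cv))))
    (by
      rintro ⟨t, p⟩ ⟨ht, hp⟩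
      have ht1 : 0 ≤ 1 - t := by linarith [ht.2]
      have h1 := trunc_supp (hxm p hp).1 (hu0 p)
      refine ⟨add_nonneg (mul_nonneg ht1 (hv0 p)) ht.1, Cn_supp (hxm p hp)
        (fun a => mul_nonneg ht1 (le_max_right _ _)) (fun a ha => h1 a (right_ne_zero_of_mul ha)), ?_⟩
      intro _
      exact (nsupp_mono fun a ha => right_ne_zero_of_mul ha).trans (us_trunc k (x p)))
    (by
      rintro ⟨t, p⟩ ⟨ht, hp⟩
      have ht1 : 0 ≤ 1 - t := by linarith [ht.2]
      have h1 := trunc_supp (hym p hp).1 (hv0 p)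
      refine ⟨mul_nonneg ht1 (hu0 p), Cn_supp (hym p hp)
        (fun a => mul_nonneg ht1 (le_max_right _ _)) (fun a ha => h1 a (right_ne_zero_of_mul ha)), ?_⟩
      intro _
      exact (nsupp_mono fun a ha => right_ne_zero_of_mul ha).trans (us_trunc l (y p)))
    (by
      rintro ⟨t, p⟩ ⟨ht, hp⟩
      simp only [← Finset.mul_sum]
      have ht1 : 0 ≤ 1 - t := by linarith [ht.2]
      have e3 : 0 ≤ ∑ a, max (x p a - u p) 0 := Finset.sum_nonneg fun a _ => le_max_right _ _
      have e4 : 0 ≤ ∑ a, max (y p a - v p) 0 := Finset.sum_nonneg fun a _ => le_max_right _ _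
      have f5 := hu0 p
      have f6 := hv0 p
      have f1 := mul_nonneg ht1 (hv0 p)
      have f2 := mul_nonneg ht1 (hu0 p)
      have f3 := mul_nonneg ht1 e3
      have f4 := mul_nonneg ht1 e4
      rcases ht.1.eq_or_lt with h1 | h1
      · simp only at h1
        rw [← h1]
        rcases (hv0 p).eq_or_lt with h1 | h1
        · rcases (hu0 p).eq_or_lt with h2 | h2
          · rw [← h1, ← h2]
            have := (hA' p hp).2.1
            rw [← hxy p hp] at this
            simp only [Pi.add_apply, Finset.sum_add_distrib] at this
            simp only [sub_zero, max_eq_left ((hxm p hp).1 _), max_eq_left ((hym p hp).1 _)]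
            linarith
          · linarith
        · linarith
      · simp only at h1
        linarith)
  refine fills_of_homotopy _ H2c H2M ?_ ?_
  · intro p hp
    simp
  · simp only [sub_self, zero_mul, zero_add]
    refine ⟨fun _ => N (ρ (1, fun _ => 0) + η (0, fun _ => 0)), continuousOn_const, ?_, fun _ _ => rfl⟩
    intro _ _
    refine ptw _ _ ⟨zero_le_one, ⟨by simp, by simp, by simp⟩, fun _ => ?_⟩
      ⟨le_rfl, ⟨by simp, by simp, by simp⟩, by simp⟩ (by simp)
    simp [nsupp]

lemma sphere_zero_empty (x : Fin 0 → ℝ) : x ∉ sphere (0 : Fin 0 → ℝ) 1 := by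
  intro hx
  have h : x = 0 := Subsingleton.elim _ _
  rw [h, mem_sphere, dist_self] at hx
  exact zero_ne_one hx

lemma setConn_of_lt {V : Type*} [TopologicalSpace V] {n : ℤ} {Y : Set V} (h : n < -1) :
    SetConn n Y := fun m hm => by omega

lemma conn_neg_one {α : Type*} [Fintype α] {R : α → α → Prop} {S : Set α} (h : S.Nonempty) :
    SetConn (-1) (rz (CK R S)) := by
  classical
  obtain ⟨c, hc⟩ := h
  intro m hm g hg hgM
  have : m = 0 := by omega
  subst this
  refine ⟨fun _ => Pi.single c 1, continuousOn_const, fun _ _ => ?_, fun x hx => ?_⟩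
  · have h1 : ∀ a, (Pi.single c 1 : α → ℝ) a ≠ 0 → a = c := fun a ha => by
      by_contra h
      simp [h] at ha
    refine mem_rz.2 ⟨fun a => ?_, by simp, fun a ha => h1 a ha ▸ hc, fun a b ha hb hab =>
      absurd ((h1 a ha).trans (h1 b hb).symm) hab⟩
    by_cases h : a = c
    · subst h; simp
    · simp [h]
  · exact absurd hx (sphere_zero_empty x)

lemma join {α : Type*} [Fintype α] {R : α → α → Prop} (hR : ∀ a b, R a b → R b a)
    {A B : Set α} (hAB : ∀ a ∈ A, ∀ b ∈ B, R a b) (hd : Disjoint A B) {a b n : ℤ}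
    (ha : -2 ≤ a) (hb : -2 ≤ b) (hn : n ≤ a + b + 2)
    (hA : SetConn a (rz (CK R A))) (hB : SetConn b (rz (CK R B))) :
    SetConn n (rz (CK R (A ∪ B))) := by
  rcases A.eq_empty_or_nonempty with rfl | hAn
  · rw [empty_union]
    have : a < -1 := by
      by_contra h
      obtain ⟨G, -, h1, -⟩ := hA 0 (by push_cast; omega) (fun _ _ => 0) continuousOn_const
        (fun x hx => by
          exact absurd hx (sphere_zero_empty x))
      have h2 := mem_rz.1 (h1 (x := 0) (by simp))
      have h3 : ∑ a, G 0 a = 0 := Finset.sum_eq_zero fun a _ => by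
        by_contra h
        exact h2.2.2.1 a h
      linarith [h2.2.1]
    exact hB.mono (by omega)
  rcases B.eq_empty_or_nonempty with rfl | hBn
  · rw [union_empty]
    have : b < -1 := by
      by_contra h
      obtain ⟨G, -, h1, -⟩ := hB 0 (by push_cast; omega) (fun _ _ => 0) continuousOn_const
        (fun x hx => by
          exact absurd hx (sphere_zero_empty x))
      have h2 := mem_rz.1 (h1 (x := 0) (by simp))
      have h3 : ∑ a, G 0 a = 0 := Finset.sum_eq_zero fun a _ => by
        by_contra h
        exact h2.2.2.1 a h
      linarith [h2.2.1]
    exact hA.mono (by omega)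
  have key : ∀ (A : Set α) (a : ℤ), -2 ≤ a → A.Nonempty → SetConn a (rz (CK R A)) →
      ∃ k : ℕ, a ≤ (k : ℤ) - 1 ∧ SetConn ((k : ℤ) - 1) (rz (CK R A)) := by
    intro A a ha hAn hA
    by_cases h : a = -2
    · exact ⟨0, by push_cast; omega, by simpa using conn_neg_one hAn⟩
    · refine ⟨(a + 1).toNat, by omega, ?_⟩
      have : (((a + 1).toNat : ℕ) : ℤ) - 1 = a := by omega
      rw [this]
      exact hA
  obtain ⟨k, hk, hk'⟩ := key A a ha hAn hA
  obtain ⟨l, hl, hl'⟩ := key B b hb hBn hB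
  exact (join_nat hR hAB hd hk' hl').mono (by omega)

end QF

namespace QF

lemma transport {α β : Type*} [Fintype α] [Fintype β] {ι : α → β} (hι : Function.Injective ι)
    {R : α → α → Prop} {R' : β → β → Prop} (hRR : ∀ a b, R' (ι a) (ι b) ↔ R a b) {S : Set α}
    {n : ℤ} : SetConn n (rz (CK R S)) ↔ SetConn n (rz (CK R' (ι '' S))) := by
  classical
  set push : (α → ℝ) → β → ℝ := fun z => Function.extend ι z 0 with hpush
  set pull : (β → ℝ) → α → ℝ := fun w a => w (ι a) with hpull
  have hpc : Continuous push := by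
    refine continuous_pi fun b => ?_
    by_cases h : ∃ a, ι a = b
    · obtain ⟨a, rfl⟩ := h
      simp only [hpush, hι.extend_apply]
      fun_prop
    · simp only [hpush, Function.extend_apply' _ _ _ h]
      fun_prop
  have hlc : Continuous pull := by fun_prop
  have e1 : ∀ z, pull (push z) = z := fun z => by
    ext a
    simp [hpush, hpull, hι.extend_apply]
  have hps : ∀ z b, push z b ≠ 0 → ∃ a, ι a = b ∧ z a ≠ 0 := by
    intro z b hb
    by_cases h : ∃ a, ι a = b
    · obtain ⟨a, rfl⟩ := h
      refine ⟨a, rfl, ?_⟩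
      simpa only [hpush, hι.extend_apply] using hb
    · simp only [hpush, Function.extend_apply' _ _ _ h] at hb
      exact absurd rfl hb
  have hpM : MapsTo push (rz (CK R S)) (rz (CK R' (ι '' S))) := by
    intro z hz
    rw [mem_rz] at hz ⊢
    refine ⟨fun b => ?_, ?_, fun b hb => ?_, fun b b' hb hb' hbb => ?_⟩
    · by_cases h : ∃ a, ι a = b
      · obtain ⟨a, rfl⟩ := h
        simp only [hpush, hι.extend_apply]
        exact hz.1 a
      · simp only [hpush, Function.extend_apply' _ _ _ h]
        exact le_rfl
    · rw [← hz.2.1]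
      symm
      refine Fintype.sum_of_injective ι hι _ _ (fun b hb => ?_) (fun a => ?_)
      · by_contra h
        obtain ⟨a, ha, -⟩ := hps z b h
        exact hb ⟨a, ha⟩
      · simp only [hpush, hι.extend_apply]
    · obtain ⟨a, rfl, ha⟩ := hps z b hb
      exact ⟨a, hz.2.2.1 a ha, rfl⟩
    · obtain ⟨a, rfl, ha⟩ := hps z b hb
      obtain ⟨a', rfl, ha'⟩ := hps z b' hb'
      exact (hRR _ _).2 (hz.2.2.2 a a' ha ha' fun h => hbb (h ▸ rfl))
  have hz0 : ∀ w ∈ rz (CK R' (ι '' S)), ∀ b ∉ range ι, w b = 0 := by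
    intro w hw b hb
    by_contra h
    obtain ⟨a, -, ha⟩ := (mem_rz.1 hw).2.2.1 b h
    exact hb ⟨a, ha⟩
  have hlM : MapsTo pull (rz (CK R' (ι '' S))) (rz (CK R S)) := by
    intro w hw
    have hw' := mem_rz.1 hw
    refine mem_rz.2 ⟨fun a => hw'.1 _, ?_, fun a ha => ?_, fun a b ha hb hab => ?_⟩
    · rw [← hw'.2.1]
      exact Fintype.sum_of_injective ι hι _ _ (hz0 w hw) (fun a => rfl)
    · obtain ⟨a', ha', h⟩ := hw'.2.2.1 _ ha
      exact hι h ▸ ha'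
    · exact (hRR _ _).1 (hw'.2.2.2 _ _ ha hb fun h => hab (hι h))
  have e2 : ∀ w ∈ rz (CK R' (ι '' S)), push (pull w) = w := by
    intro w hw
    ext b
    by_cases h : ∃ a, ι a = b
    · obtain ⟨a, rfl⟩ := h
      simp [hpush, hpull, hι.extend_apply]
    · simp only [hpush, Function.extend_apply' _ _ _ h]
      exact (hz0 w hw b h).symm
  exact ⟨fun h => h.retract push pull hpc.continuousOn hpM hlc.continuousOn hlM e2,
    fun h => h.retract pull push hlc.continuousOn hlM hpc.continuousOn hpM fun z _ => e1 z⟩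

/-- comparability -/
def cmp {P : Type*} [PartialOrder P] (a b : P) : Prop := a ≤ b ∨ b ≤ a

lemma cmp_symm {P : Type*} [PartialOrder P] {a b : P} (h : cmp a b) : cmp b a := Or.symm h

/-- vertex set of the link of a chain -/
def Lk {P : Type*} [PartialOrder P] (σ : Finset P) : Set P := {x | x ∉ σ ∧ ∀ y ∈ σ, cmp x y}

lemma chainFace_iff {P : Type*} [PartialOrder P] (τ : Finset P) :
    ChainFace P τ ↔ CK cmp (Lk (∅ : Finset P)) τ := by
  constructor
  · rintro ⟨h1, h2⟩
    exact ⟨h1, fun x _ => ⟨by simp, by simp⟩, h2⟩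
  · rintro ⟨h1, -, h2⟩
    exact ⟨h1, h2⟩

lemma linkFace_iff {P : Type*} [PartialOrder P] [DecidableEq P] {σ : Finset P}
    (hσ : ChainFace P σ) (τ : Finset P) :
    LinkFace (ChainFace P) σ τ ↔ CK cmp (Lk σ) τ := by
  constructor
  · rintro ⟨h1, h2, h3, h4⟩
    refine ⟨h1, fun x hx => ⟨Finset.disjoint_left.1 h2 hx, fun y hy => ?_⟩, h4.mono ?_⟩
    · refine h4 (by simp [hx]) (by simp [hy]) ?_
      rintro rfl
      exact Finset.disjoint_left.1 h2 hx hy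
    · simp
  · rintro ⟨h1, h2, h3⟩
    refine ⟨h1, Finset.disjoint_left.2 fun x hx => (h2 x hx).1, h1.mono Finset.subset_union_left, ?_⟩
    intro x hx y hy hxy
    simp only [Finset.coe_union, mem_union, Finset.mem_coe] at hx hy
    rcases hx with hx | hx <;> rcases hy with hy | hy
    · exact h3 hx hy hxy
    · exact (h2 x hx).2 y hy
    · exact cmp_symm ((h2 y hy).2 x hx)
    · exact hσ.2 hx hy hxy

lemma spherical_iff {P : Type*} [PartialOrder P] [Fintype P] {σ : Finset P}
    {K : Finset P → Prop} (hK : ∀ τ, K τ ↔ CK cmp (Lk σ) τ) (d : ℤ) :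
    IsSpherical (d - σ.card) K ↔
      (∀ τ, CK cmp (Lk σ) τ → (τ.card : ℤ) + σ.card ≤ d + 1) ∧
      ((σ.card : ℤ) ≤ d → ∃ τ, CK cmp (Lk σ) τ ∧ (τ.card : ℤ) + σ.card = d + 1) ∧
      SetConn (d - σ.card - 1) (rz (CK cmp (Lk σ))) := by
  have : K = CK cmp (Lk σ) := funext fun τ => propext (hK τ)
  subst this
  unfold IsSpherical
  refine and_congr ?_ (and_congr ?_ ⟨setConn_of_isConn, isConn_of_setConn⟩)
  · exact forall_congr' fun τ => imp_congr_right fun _ => by omega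
  · refine imp_congr (by omega) (exists_congr fun τ => and_congr_right fun _ => by omega)

lemma CM_iff {P : Type*} [PartialOrder P] [Fintype P] (d : ℤ) :
    PosetCM P d ↔ ∀ σ : Finset P, (σ : Set P).Pairwise cmp →
      (∀ τ, CK cmp (Lk σ) τ → (τ.card : ℤ) + σ.card ≤ d + 1) ∧
      ((σ.card : ℤ) ≤ d → ∃ τ, CK cmp (Lk σ) τ ∧ (τ.card : ℤ) + σ.card = d + 1) ∧
      SetConn (d - σ.card - 1) (rz (CK cmp (Lk σ))) := by
  classical
  have h0 := spherical_iff (σ := (∅ : Finset P)) chainFace_iff d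
  rw [Finset.card_empty, Nat.cast_zero, sub_zero] at h0
  constructor
  · rintro ⟨h1, h2⟩ σ hσ
    rcases σ.eq_empty_or_nonempty with rfl | hne
    · simpa using h0.1 h1
    · exact (spherical_iff (linkFace_iff ⟨hne, hσ⟩) d).1 (h2 σ ⟨hne, hσ⟩)
  · intro h
    refine ⟨h0.2 (by simpa using h ∅ (by simp)), fun σ hσ => ?_⟩
    exact (spherical_iff (linkFace_iff hσ) d).2 (h σ hσ.2)

/-- comparability relation on the mapping cylinder -/
def RM {P Q : Type*} [PartialOrder P] [PartialOrder Q] (f : P → Q) : P ⊕ Q → P ⊕ Q → Prop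
  | Sum.inl a, Sum.inl b => cmp a b
  | Sum.inr a, Sum.inr b => cmp a b
  | Sum.inl a, Sum.inr b => f a ≤ b
  | Sum.inr a, Sum.inl b => f b ≤ a

lemma RM_symm {P Q : Type*} [PartialOrder P] [PartialOrder Q] (f : P → Q) :
    ∀ a b, RM f a b → RM f b a := by
  rintro (a | a) (b | b) h
  · exact cmp_symm h
  · exact h
  · exact h
  · exact cmp_symm h

lemma add_step {P Q : Type*} [PartialOrder P] [PartialOrder Q] [Fintype P] [Fintype Q]
    {f : P → Q} (hf : Monotone f) {n : ℤ} {L0 : Set P} {C : Set Q}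
    (hbase : SetConn n (rz (CK (RM f) (Sum.inl '' L0 ∪ Sum.inr '' C))))
    (hL0 : ∀ l ∈ L0, ∀ q ∈ C, f l ≤ q) (k : ℕ) : ∀ T : Finset P, T.card = k →
    (∀ l ∈ T, l ∉ L0 ∧ f l ∈ C) →
    SetConn n (rz (CK (RM f) (Sum.inl '' (L0 ∪ T) ∪ Sum.inr '' C))) := by
  classical
  induction k with
  | zero =>
    intro T hT _
    rw [Finset.card_eq_zero] at hT
    subst hT
    simpa using hbase
  | succ k ih =>
    intro T hT h
    have hne : T.Nonempty := Finset.card_pos.1 (by omega)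
    obtain ⟨l, hl⟩ := T.exists_maximal hne
    have hlT : l ∈ T := hl.1
    have ih' := ih (T.erase l) (by rw [Finset.card_erase_of_mem hlT]; omega)
      (fun x hx => h x (Finset.mem_of_mem_erase hx))
    have := lemC (RM_symm f) (c := Sum.inl l) (e := Sum.inr (f l)) (by
        simp [(h l hlT).1]) (Or.inr ⟨f l, (h l hlT).2, rfl⟩) (show f l ≤ f l from le_rfl) (by
        rintro x (⟨x, hx | hx, rfl⟩ | ⟨x, hx, rfl⟩) hxc hxe
        · exact hL0 x hx _ (h l hlT).2
        · refine hf ?_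
          rcases hxc with hxc | hxc
          · exact hxc
          · exact hl.2 (Finset.mem_of_mem_erase hx) hxc
        · exact Or.inr hxc) ih'
    convert this using 4
    ext x
    constructor
    · rintro (⟨x, hx | hx, rfl⟩ | hx)
      · exact Or.inr (Or.inl ⟨x, Or.inl hx, rfl⟩)
      · by_cases hxl : x = l
        · exact Or.inl (by rw [hxl])
        · exact Or.inr (Or.inl ⟨x, Or.inr (by simpa [hxl] using hx), rfl⟩)
      · exact Or.inr (Or.inr hx)
    · rintro (rfl | ⟨x, hx | hx, rfl⟩ | hx)
      · exact Or.inl ⟨l, Or.inr hlT, rfl⟩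
      · exact Or.inl ⟨x, Or.inl hx, rfl⟩
      · exact Or.inl ⟨x, Or.inr (Finset.mem_of_mem_erase hx), rfl⟩
      · exact Or.inr hx

lemma remove_step {P Q : Type*} [PartialOrder P] [PartialOrder Q] [Fintype P] [Fintype Q]
    {f : P → Q} {n : ℤ} {L : Set P} (k : ℕ) : ∀ U : Finset Q, U.card = k →
    (∀ q ∈ U, ∀ q', q ≤ q' → q' ∈ U) →
    (∀ q ∈ U, SetConn n (rz (CK (RM f) (Sum.inl '' {l | l ∈ L ∧ f l ≤ q} ∪ Sum.inr '' Ioi q)))) →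
    SetConn n (rz (CK (RM f) (Sum.inl '' L ∪ Sum.inr '' (U : Set Q)))) →
    SetConn n (rz (CK (RM f) (Sum.inl '' L))) := by
  classical
  induction k with
  | zero =>
    intro U hU _ _ h
    rw [Finset.card_eq_zero] at hU
    subst hU
    simpa using h
  | succ k ih =>
    intro U hU hup hlk h
    have hne : U.Nonempty := Finset.card_pos.1 (by omega)
    obtain ⟨q, hq⟩ := U.exists_minimal hne
    have hqU : q ∈ U := hq.1
    refine ih (U.erase q) (by rw [Finset.card_erase_of_mem hqU]; omega) ?_
      (fun x hx => hlk x (Finset.mem_of_mem_erase hx)) ?_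
    · intro a ha b hab
      refine Finset.mem_erase.2 ⟨?_, hup a (Finset.mem_of_mem_erase ha) b hab⟩
      rintro rfl
      exact (Finset.mem_erase.1 ha).1 (le_antisymm hab (hq.2 (Finset.mem_of_mem_erase ha) hab))
    · refine lemR (c := Sum.inr q) (by simp) ?_ ?_
      · convert hlk q hqU using 4
        ext x
        constructor
        · rintro ⟨⟨x, hx, rfl⟩ | ⟨x, hx, rfl⟩, hR⟩
          · exact Or.inl ⟨x, ⟨hx, hR⟩, rfl⟩
          · refine Or.inr ⟨x, ?_, rfl⟩
            obtain ⟨h1, h2⟩ := Finset.mem_erase.1 hx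
            rcases hR with hR | hR
            · exact absurd (le_antisymm hR (hq.2 h2 hR)) h1
            · exact lt_of_le_of_ne hR (Ne.symm h1)
        · rintro (⟨x, hx, rfl⟩ | ⟨x, hx, rfl⟩)
          · exact ⟨Or.inl ⟨x, hx.1, rfl⟩, hx.2⟩
          · exact ⟨Or.inr ⟨x, Finset.mem_erase.2 ⟨(ne_of_lt hx).symm, hup q hqU x (le_of_lt hx)⟩,
              rfl⟩, Or.inr (le_of_lt hx)⟩
      · convert h using 4
        ext x
        constructor
        · rintro (rfl | hx | ⟨x, hx, rfl⟩)
          · exact Or.inr ⟨q, hqU, rfl⟩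
          · exact Or.inl hx
          · exact Or.inr ⟨x, Finset.mem_of_mem_erase hx, rfl⟩
        · rintro (hx | ⟨x, hx, rfl⟩)
          · exact Or.inr (Or.inl hx)
          · by_cases hxq : x = q
            · exact Or.inl (by rw [hxq])
            · exact Or.inr (Or.inr ⟨x, Finset.mem_erase.2 ⟨hxq, hx⟩, rfl⟩)

lemma main_conn {P Q : Type*} [PartialOrder P] [PartialOrder Q] [Fintype P] [Fintype Q]
    {f : P → Q} (hf : Monotone f) {n : ℤ} {L L0 : Set P} {C : Set Q} (hLL : L0 ⊆ L)
    (hC : ∀ q ∈ C, ∀ q', q ≤ q' → q' ∈ C)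
    (hbase : SetConn n (rz (CK (RM f) (Sum.inl '' L0 ∪ Sum.inr '' C))))
    (hL0 : ∀ l ∈ L0, ∀ q ∈ C, f l ≤ q) (hL : ∀ l ∈ L, l ∉ L0 → f l ∈ C)
    (hlk : ∀ q ∈ C,
      SetConn n (rz (CK (RM f) (Sum.inl '' {l | l ∈ L ∧ f l ≤ q} ∪ Sum.inr '' Ioi q)))) :
    SetConn n (rz (CK cmp L)) := by
  classical
  rw [transport (ι := (Sum.inl : P → P ⊕ Q)) Sum.inl_injective (R := cmp) (R' := RM f) (fun a b => Iff.rfl)]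
  have h1 := add_step hf hbase hL0 _ (Finset.univ.filter fun l => l ∈ L ∧ l ∉ L0) rfl (by
    intro l hl
    simp only [Finset.mem_filter, Finset.mem_univ, true_and] at hl
    exact ⟨hl.2, hL l hl.1 hl.2⟩)
  refine remove_step _ (Finset.univ.filter fun q => q ∈ C) rfl (by simpa using hC)
    (by simpa using hlk) ?_
  convert h1 using 6
  · ext l
    simp only [Finset.coe_filter, Finset.mem_univ, true_and, mem_union, mem_ofPred_eq]
    constructor
    · intro h
      by_cases h' : l ∈ L0
      · exact Or.inl h'
      · exact Or.inr ⟨h, h'⟩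
    · rintro (h | h)
      · exact hLL h
      · exact h.1
  · simp

end QF

namespace QF

lemma height_chain {Q : Type*} [PartialOrder Q] [Fintype Q] (q : Q) :
    ∃ σ : Finset Q, (σ : Set Q).Pairwise cmp ∧ q ∈ σ ∧ (∀ x ∈ σ, x ≤ q) ∧
      σ.card = posetHeight q + 1 := by
  classical
  have hne : ((Finset.univ : Finset (Finset Q)).filter fun σ =>
      ChainFace Q σ ∧ q ∈ σ ∧ ∀ x ∈ σ, x ≤ q).Nonempty :=
    ⟨{q}, Finset.mem_filter.2 ⟨Finset.mem_univ _, ⟨by simp, by simp⟩, by simp, by simp⟩⟩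
  obtain ⟨σ, hσ, he⟩ := Finset.exists_mem_eq_sup _ hne Finset.card
  simp only [Finset.mem_filter, Finset.mem_univ, true_and] at hσ
  refine ⟨σ, hσ.1.2, hσ.2.1, hσ.2.2, ?_⟩
  have : 0 < σ.card := Finset.card_pos.2 hσ.1.1
  have h2 : posetHeight q = σ.card - 1 := by
    rw [← he]
    unfold posetHeight
    congr!
  omega

lemma height_max {Q : Type*} [PartialOrder Q] [Fintype Q] {q : Q} {σ : Finset Q}
    (h1 : (σ : Set Q).Pairwise cmp) (h2 : q ∈ σ) (h3 : ∀ x ∈ σ, x ≤ q) :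
    σ.card ≤ posetHeight q + 1 := by
  classical
  have := Finset.le_sup (f := Finset.card) (s := (Finset.univ : Finset (Finset Q)).filter fun σ =>
      ChainFace Q σ ∧ q ∈ σ ∧ ∀ x ∈ σ, x ≤ q) (b := σ)
      (Finset.mem_filter.2 ⟨Finset.mem_univ _, ⟨⟨q, h2⟩, h1⟩, h2, h3⟩)
  have h4 : posetHeight q = ((Finset.univ : Finset (Finset Q)).filter fun σ =>
      ChainFace Q σ ∧ q ∈ σ ∧ ∀ x ∈ σ, x ≤ q).sup Finset.card - 1 := by
    unfold posetHeight
    congr!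
  omega

lemma Lk_height {Q : Type*} [PartialOrder Q] [Fintype Q] {q : Q} {σ : Finset Q}
    (h1 : (σ : Set Q).Pairwise cmp) (h2 : q ∈ σ) (h3 : ∀ x ∈ σ, x ≤ q)
    (h4 : σ.card = posetHeight q + 1) : Lk σ = Ioi q := by
  classical
  ext x
  constructor
  · rintro ⟨hx, hc⟩
    have hxq : x ≠ q := fun h => hx (h ▸ h2)
    rcases hc q h2 with h | h
    · exfalso
      have := height_max (q := q) (σ := insert x σ) (by
        rw [Finset.coe_insert]
        refine h1.insert fun b hb _ => ⟨hc b hb, cmp_symm (hc b hb)⟩) (by simp [h2])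
        (by
          intro y hy
          rcases Finset.mem_insert.1 hy with rfl | hy
          · exact h
          · exact h3 y hy)
      rw [Finset.card_insert_of_notMem hx] at this
      omega
    · exact lt_of_le_of_ne h (Ne.symm hxq)
  · intro hx
    exact ⟨fun h => absurd (h3 x h) (not_le_of_gt hx), fun y hy => Or.inr ((h3 y hy).trans (le_of_lt hx))⟩

lemma upper {Q : Type*} [PartialOrder Q] [Fintype Q] {d : ℤ} (hQ : PosetCM Q d) (q : Q) :
    (posetHeight q : ℤ) ≤ d ∧ SetConn (d - posetHeight q - 2) (rz (CK cmp (Ioi q))) ∧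
    ∃ q', q ≤ q' ∧ (posetHeight q' : ℤ) = d := by
  rw [CM_iff] at hQ
  have key : ∀ q : Q, (posetHeight q : ℤ) ≤ d ∧
      SetConn (d - posetHeight q - 2) (rz (CK cmp (Ioi q))) ∧
      ((posetHeight q : ℤ) + 1 ≤ d → (Ioi q).Nonempty) := by
    intro q
    obtain ⟨σ, h1, h2, h3, h4⟩ := height_chain q
    obtain ⟨a1, a2, a3⟩ := hQ σ h1
    have a0 := (hQ ∅ (by simp)).1 σ ((chainFace_iff σ).1 ⟨⟨q, h2⟩, h1⟩)
    rw [Lk_height h1 h2 h3 h4, h4] at a3 a2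
    rw [h4] at a0
    refine ⟨by simp at a0; omega, ?_, fun h => ?_⟩
    · convert a3 using 1
      push_cast
      ring
    · obtain ⟨τ, hτ, -⟩ := a2 (by push_cast; omega)
      obtain ⟨x, hx⟩ := hτ.1
      exact ⟨x, hτ.2.1 x hx⟩
  refine ⟨(key q).1, (key q).2.1, ?_⟩
  obtain ⟨q', h1, h2⟩ := (Set.toFinite (Ici q)).exists_le_maximal (a := q) (by simp)
  refine ⟨q', h1, le_antisymm (key q').1 ?_⟩
  by_contra h
  obtain ⟨x, hx⟩ := (key q').2.2 (by omega)
  exact absurd (h2.2 (h1.trans (le_of_lt hx)) (le_of_lt hx)) (not_le_of_gt hx)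

lemma fiber {P Q : Type*} [PartialOrder P] [PartialOrder Q] [Fintype P]
    {f : P → Q} {q : Q} {h : ℤ} {inst : Fintype {p : P // f p ≤ q}}
    (hF : PosetCM {p : P // f p ≤ q} h) {σ : Finset P} (hσ : (σ : Set P).Pairwise cmp)
    (hq : ∀ x ∈ σ, f x ≤ q) :
    (σ.card : ℤ) ≤ max h (-1) + 1 ∧
    ((σ.card : ℤ) ≤ h → ∃ τ, CK cmp (Lk σ) τ ∧ (τ.card : ℤ) + σ.card = h + 1) ∧
    SetConn (h - σ.card - 1) (rz (CK cmp {l | l ∈ Lk σ ∧ f l ≤ q})) := by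
  classical
  rw [CM_iff] at hF
  set σ' : Finset {p : P // f p ≤ q} := σ.subtype (fun p => f p ≤ q) with hσ'
  have hm : ∀ x, x ∈ σ' ↔ x.1 ∈ σ := fun x => by simp [hσ']
  have hcard : σ'.card = σ.card := by
    rw [hσ', Finset.card_subtype, Finset.filter_true_of_mem hq]
  have hch : (σ' : Set {p : P // f p ≤ q}).Pairwise cmp := by
    intro a ha b hb hab
    exact hσ ((hm a).1 ha) ((hm b).1 hb) fun h => hab (Subtype.ext h)
  have hLk : Subtype.val '' (Lk σ') = {l | l ∈ Lk σ ∧ f l ≤ q} := by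
    ext x
    constructor
    · rintro ⟨x, hx, rfl⟩
      refine ⟨⟨fun h => hx.1 ((hm x).2 h), fun y hy => ?_⟩, x.2⟩
      exact hx.2 ⟨y, hq y hy⟩ ((hm _).2 hy)
    · rintro ⟨hx, hxq⟩
      exact ⟨⟨x, hxq⟩, ⟨fun h => hx.1 ((hm _).1 h), fun y hy => hx.2 y.1 ((hm _).1 hy)⟩, rfl⟩
  obtain ⟨-, a2, a3⟩ := hF σ' hch
  rw [hcard] at a2 a3
  refine ⟨?_, fun h => ?_, ?_⟩
  · rcases σ.eq_empty_or_nonempty with rfl | hne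
    · simp
      omega
    · have := (hF ∅ (by simp)).1 σ' ((chainFace_iff σ').1
        ⟨Finset.card_pos.1 (by rw [hcard]; exact Finset.card_pos.2 hne), hch⟩)
      simp [hcard] at this
      omega
  · obtain ⟨τ, hτ, hc⟩ := a2 h
    refine ⟨τ.map ⟨Subtype.val, Subtype.val_injective⟩, ⟨by simpa using hτ.1, ?_, ?_⟩, by
      rw [Finset.card_map]; exact hc⟩
    · intro x hx
      obtain ⟨y, hy, rfl⟩ := Finset.mem_map.1 hx
      have : y.1 ∈ {l | l ∈ Lk σ ∧ f l ≤ q} := hLk ▸ ⟨y, hτ.2.1 y hy, rfl⟩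
      exact this.1
    · intro a ha b hb hab
      obtain ⟨a, ha', rfl⟩ := Finset.mem_map.1 ha
      obtain ⟨b, hb', rfl⟩ := Finset.mem_map.1 hb
      exact hτ.2.2 ha' hb' fun h => hab (h ▸ rfl)
  · rw [← hLk, ← transport Subtype.val_injective (R := cmp) (R' := cmp) (fun a b => Iff.rfl)]
    exact a3

theorem main {P Q : Type*} [PartialOrder P] [Fintype P]
    [PartialOrder Q] [Fintype Q] (f : P → Q) (hf : StrictMono f) (d : ℤ)
    (hQ : PosetCM Q d) {inst : ∀ q : Q, Fintype {p : P // f p ≤ q}}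
    (hfib : ∀ q : Q, PosetCM {p : P // f p ≤ q} (posetHeight q)) :
    PosetCM P d := by
  classical
  rw [CM_iff]
  have hQ' := (CM_iff d).1 hQ
  intro σ hσ
  -- upper bound on the size of chains
  refine ⟨fun τ hτ => ?_, fun hd => ?_, ?_⟩
  · have hdis : Disjoint τ σ := Finset.disjoint_left.2 fun x hx => (hτ.2.1 x hx).1
    have hch : ((τ ∪ σ : Finset P) : Set P).Pairwise cmp := by
      intro x hx y hy hxy
      simp only [Finset.coe_union, mem_union, Finset.mem_coe] at hx hy
      rcases hx with hx | hx <;> rcases hy with hy | hy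
      · exact hτ.2.2 hx hy hxy
      · exact (hτ.2.1 x hx).2 y hy
      · exact cmp_symm ((hτ.2.1 y hy).2 x hx)
      · exact hσ hx hy hxy
    have hinj : Set.InjOn f ((τ ∪ σ : Finset P) : Set P) := by
      intro x hx y hy hxy
      by_contra hne
      rcases hch hx hy hne with h | h
      · exact absurd hxy (hf (lt_of_le_of_ne h hne)).ne
      · exact absurd hxy (hf (lt_of_le_of_ne h (Ne.symm hne))).ne'
    have := (hQ' ∅ (by simp)).1 ((τ ∪ σ).image f) ((chainFace_iff _).1 ⟨?_, ?_⟩)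
    · rw [Finset.card_image_of_injOn hinj, Finset.card_union_of_disjoint hdis] at this
      simpa using this
    · exact (hτ.1.mono Finset.subset_union_left).image f
    · intro a ha b hb hab
      obtain ⟨x, hx, rfl⟩ := Finset.mem_image.1 ha
      obtain ⟨y, hy, rfl⟩ := Finset.mem_image.1 hb
      exact (hch hx hy fun h => hab (h ▸ rfl)).imp (fun h => hf.monotone h) (fun h => hf.monotone h)
  · have : ∃ q0, ∀ x ∈ σ, f x ≤ q0 := by
      rcases σ.eq_empty_or_nonempty with rfl | hne
      · obtain ⟨τ, hτ, -⟩ := (hQ' ∅ (by simp)).2.1 (by simpa using hd)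
        obtain ⟨q, -⟩ := hτ.1
        exact ⟨q, by simp⟩
      · obtain ⟨p, hp⟩ := σ.exists_maximal hne
        refine ⟨f p, fun x hx => hf.monotone ?_⟩
        by_cases hxp : x = p
        · rw [hxp]
        · rcases hσ hx hp.1 hxp with h | h
          · exact h
          · exact hp.2 hx h
    obtain ⟨q0, hq0⟩ := this
    obtain ⟨-, -, q, hq, hqd⟩ := upper hQ q0
    have := (fiber (hfib q) hσ fun x hx => (hq0 x hx).trans hq).2.1
    rw [hqd] at this
    exact this hd
  · have J : ∀ q, (∀ x ∈ σ, f x ≤ q) → SetConn (d - σ.card - 1) (rz (CK (RM f)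
        (Sum.inl '' {l | l ∈ Lk σ ∧ f l ≤ q} ∪ Sum.inr '' Ioi q))) := by
      intro q hq
      obtain ⟨h1, -, h2⟩ := fiber (hfib q) hσ hq
      obtain ⟨h3, h4, -⟩ := upper hQ q
      rw [transport (ι := (Sum.inl : P → P ⊕ Q)) Sum.inl_injective (R := cmp) (R' := RM f)
        (fun a b => Iff.rfl)] at h2
      rw [transport (ι := (Sum.inr : Q → P ⊕ Q)) Sum.inr_injective (R := cmp) (R' := RM f)
        (fun a b => Iff.rfl)] at h4
      refine join (RM_symm f) ?_ ?_ ?_ ?_ ?_ h2 h4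
      · rintro _ ⟨a, ha, rfl⟩ _ ⟨b, hb, rfl⟩
        exact ha.2.trans (le_of_lt hb)
      · rw [disjoint_left]
        rintro _ ⟨a, ha, rfl⟩ ⟨b, hb, h⟩
        cases h
      · omega
      · omega
      · omega
    rcases σ.eq_empty_or_nonempty with rfl | hne
    · refine main_conn hf.monotone (L0 := ∅) (C := univ) (empty_subset _) (by simp) ?_ (by simp)
        (by simp) (fun q _ => J q (by simp))
      have := (hQ' ∅ (by simp)).2.2
      rw [transport (ι := (Sum.inr : Q → P ⊕ Q)) Sum.inr_injective (R := cmp) (R' := RM f)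
        (fun a b => Iff.rfl)] at this
      have e : (Lk (∅ : Finset Q)) = univ := by ext; simp [Lk]
      rw [e] at this
      simpa using this
    · obtain ⟨p, hp⟩ := σ.exists_maximal hne
      have hpx : ∀ x ∈ σ, x ≤ p := by
        intro x hx
        by_cases hxp : x = p
        · rw [hxp]
        · rcases hσ hx hp.1 hxp with h | h
          · exact h
          · exact hp.2 hx h
      refine main_conn hf.monotone (L0 := {l | l ∈ Lk σ ∧ f l ≤ f p}) (C := Ioi (f p))
        (fun x hx => hx.1) (fun q hq q' hqq => lt_of_lt_of_le hq hqq)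
        (J (f p) fun x hx => hf.monotone (hpx x hx))
        (fun l hl q hq => hl.2.trans (le_of_lt hq)) ?_
        (fun q hq => J q fun x hx => (hf.monotone (hpx x hx)).trans (le_of_lt hq))
      intro l hl hl0
      have hlp : l ≠ p := fun h => hl.1 (h ▸ hp.1)
      rcases hl.2 p hp.1 with h | h
      · exact absurd ⟨hl, hf.monotone h⟩ hl0
      · exact hf (lt_of_le_of_ne h (Ne.symm hlp))

end QF

end QFSection

open Classical in
/-- **Quillen's fiber criterion.**  If `f : P → Q` is strictly increasing, `Q` is
Cohen-Macaulay of dimension `d`, and for every `q ∈ Q` the preimage of the closure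
`{q' : q' ≤ q}` is Cohen-Macaulay of dimension the height of `q`, then `P` is
Cohen-Macaulay of dimension `d`. -/
theorem quillen_fiber_criterion {P Q : Type*} [PartialOrder P] [Fintype P]
    [PartialOrder Q] [Fintype Q] (f : P → Q) (hf : StrictMono f) (d : ℤ)
    (hQ : PosetCM Q d)
    (hfib : ∀ q : Q, PosetCM {p : P // f p ≤ q} (posetHeight q)) :
    PosetCM P d := by
  exact QF.main f hf d hQ hfib
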